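/- arXiv:2303.15775 — 2 statements merged into one kernel-verified Lean document; each statement's English description precedes it below -/
import Mathlib

section
/- (Expansion of the slope at the axis.) Let r₀ > 0, a, b, λ ∈ ℝ, and let u ∈ C¹([0,r₀]) ∩ C^∞((0,r₀]) satisfy u'(0) = 0. Set w := u' and v := √(1+w²), and assume that on (0,r₀) the ODE w''(r) + (w(r)/r)' − [ (5w(r)/(2(1+w(r)²)))·w'(r)² + (w(r)³/(2r²))·(3+w(r)²) ] = (1/2)·v(r)⁵·a·r + b·v(r)⁴·w(r) + (λ/r)·v(r)⁵ holds. Then there exists ξ ∈ C¹([0,r₀]) such that u'(r) = (1/2)·λ·r·ln(r) + ξ(r) for all r ∈ (0,r₀]. In particular, u' is α-Hölder continuous on [0,r₀] for every α ∈ (0,1) and u'' ∈ L^p((0,r₀)) for every p ∈ [1,∞). -/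
open Real MeasureTheory

noncomputable section

/-- The (one-sided) derivative of `u` on `[0,r₀]`. -/
def slopeFn (u : ℝ → ℝ) (r₀ : ℝ) (r : ℝ) : ℝ := derivWithin u (Set.Icc 0 r₀) r

section
open Set Filter Topology

lemma sa_barrier (w : ℝ → ℝ) (r₀ K : ℝ) (hr₀ : 0 < r₀) (hwc : ContinuousOn w (Icc 0 r₀))
    (hw0 : w 0 = 0) (hw2 : ∀ r ∈ Ioo 0 r₀, ContDiffAt ℝ 2 w r)
    (hineq : ∀ r ∈ Ioo 0 r₀, 0 < w r → w r / r^2 - K / r ≤ deriv (deriv w) r + deriv w r / r) :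
    ∃ A, 0 ≤ A ∧ ∀ r ∈ Icc 0 r₀, w r ≤ A * √r := by
  have hs0 : 0 < √r₀ := Real.sqrt_pos.2 hr₀
  obtain ⟨A, hA0, hA1, hA2⟩ : ∃ A, 0 < A ∧ w r₀ ≤ A * √r₀ ∧ 4 * K * √r₀ < 3 * A := by
    refine ⟨|w r₀| / √r₀ + 2 * |K| * √r₀ + 1, by positivity, ?_, ?_⟩
    · have : |w r₀| / √r₀ * √r₀ = |w r₀| := by field_simp
      have h2 : 0 ≤ 2 * |K| * √r₀ * √r₀ := by positivity
      nlinarith [le_abs_self (w r₀)]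
    · have : 0 ≤ |w r₀| / √r₀ := by positivity
      have h2 : K * √r₀ ≤ |K| * √r₀ := by gcongr; exact le_abs_self K
      have : 0 ≤ |K| * √r₀ := by positivity
      nlinarith
  refine ⟨A, hA0.le, ?_⟩
  set f : ℝ → ℝ := fun r => w r - A * √r with hf
  have hfc : ContinuousOn f (Icc 0 r₀) := by fun_prop
  obtain ⟨x, hx, hmax⟩ := isCompact_Icc.exists_isMaxOn (nonempty_Icc.2 hr₀.le) hfc
  by_contra! hcon
  obtain ⟨r, hr, hlt⟩ := hcon
  have hfx : 0 < f x := by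
    have : f r ≤ f x := hmax hr
    have : 0 < f r := by simp only [hf]; linarith
    linarith
  have hx0 : x ≠ 0 := by
    rintro rfl
    simp [hf, hw0] at hfx
  have hx1 : x ≠ r₀ := by
    rintro rfl
    simp only [hf] at hfx; linarith
  have hxI : x ∈ Ioo 0 r₀ := ⟨lt_of_le_of_ne hx.1 hx0.symm, lt_of_le_of_ne hx.2 hx1⟩
  have hxp := hxI.1
  have hd1 : ∀ r ∈ Ioo 0 r₀, HasDerivAt f (deriv w r - A * (1 / (2 * √r))) r := by
    intro r hr
    exact ((hw2 r hr).differentiableAt (by norm_num)).hasDerivAt.sub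
      ((Real.hasDerivAt_sqrt hr.1.ne').const_mul A)
  have hev : deriv f =ᶠ[𝓝 x] fun r => deriv w r - A * (1 / (2 * √r)) := by
    filter_upwards [isOpen_Ioo.mem_nhds hxI] with r hr using (hd1 r hr).deriv
  have hsx : 0 < √x := Real.sqrt_pos.2 hxp
  have hdd : DifferentiableAt ℝ (deriv w) x := by
    have h2 : ContDiffAt ℝ 1 (deriv w) x := by
      have := ((hw2 x hxI).fderiv_right (m := 1) (by norm_num)).clm_apply (contDiffAt_const (c := (1:ℝ)))
      exact this
    exact h2.differentiableAt (by norm_num)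
  have hd2 : deriv (deriv f) x = deriv (deriv w) x + A / (4 * x * √x) := by
    rw [hev.deriv_eq]
    have h1 : HasDerivAt (fun r => A * (1 / (2 * √r))) (- (A / (4 * x * √x))) x := by
      have := (((Real.hasDerivAt_sqrt hxp.ne').const_mul 2).inv (by positivity)).const_mul A
      refine (this.congr_deriv ?_).congr_of_eventuallyEq ?_
      · have : x = √x * √x := (Real.mul_self_sqrt hxp.le).symm
        generalize √x = s at *
        subst this
        field_simp; try norm_num
      · filter_upwards with r
        simp
    have := (hdd.hasDerivAt.sub h1).deriv
    simp only [sub_neg_eq_add] at this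
    exact this
  have hlm : IsLocalMax f x := hmax.isLocalMax (Icc_mem_nhds hxI.1 hxI.2)
  have hdf0 : deriv f x = 0 := hlm.deriv_eq_zero
  have hdw : deriv w x = A * (1 / (2 * √x)) := by
    have := (hd1 x hxI).deriv; linarith
  have hwx : A * √x < w x := by simp only [hf] at hfx; linarith
  have hpos : 0 < deriv (deriv f) x := by
    have h := hineq x hxI (lt_trans (by positivity) hwx)
    rw [hd2]
    rw [hdw] at h
    have h3 : A * √x / x^2 ≤ w x / x ^2 := by gcongr
    have h4 : √x ≤ √r₀ := Real.sqrt_le_sqrt hx.2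
    have h5 : K * √x * 4 < 3 * A := by
      rcases le_or_gt K 0 with hK | hK
      · nlinarith
      · nlinarith
    have h6 : 0 < A * √x / x^2 - K / x - A * (1 / (2 * √x)) / x + A / (4 * x * √x) := by
      have : A * √x / x^2 - K / x - A * (1 / (2 * √x)) / x + A / (4 * x * √x)
        = (3 * A - K * √x * 4) / (4 * x * √x) := by
        have : x = √x * √x := (Real.mul_self_sqrt hxp.le).symm
        generalize √x = s at *
        subst this
        field_simp; ring
      rw [this]
      apply div_pos (by linarith) (by positivity)
    linarith
  have hmin := isLocalMin_of_deriv_deriv_pos hpos hdf0 (hd1 x hxI).continuousAt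
  have hconst : f =ᶠ[𝓝 x] fun _ => f x := by
    filter_upwards [hlm, hmin] with y h1 h2 using le_antisymm h1 h2
  have := hconst.deriv.deriv_eq
  simp at this
  linarith

/-- derivative bound -/
lemma sa_dbound (w S : ℝ → ℝ) (r₀ A K : ℝ) (hr₀ : 0 < r₀)
    (hA0 : 0 ≤ A) (hK0 : 0 ≤ K)
    (hw1 : ∀ r ∈ Ioo 0 r₀, HasDerivAt w (deriv w r) r)
    (hw2 : ∀ r ∈ Ioo 0 r₀, HasDerivAt (deriv w) (deriv (deriv w) r) r)
    (hA : ∀ r ∈ Ioo 0 r₀, |w r| ≤ A * √r)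
    (hS : ∀ r ∈ Ioo 0 r₀, |S r| ≤ K)
    (hE : ∀ r ∈ Ioo 0 r₀, deriv (deriv w) r = - deriv w r / r + w r / r^2
      + 5 * w r / (2 * (1 + w r ^2)) * deriv w r ^ 2 + w r ^3 / (2 * r^2) * (3 + w r ^2)
      + S r / r) :
    ∃ C, 0 ≤ C ∧ ∀ r ∈ Ioo 0 (r₀/2), |deriv w r| ≤ C / √r := by
  set M := A * √r₀ with hM
  have hM0 : 0 ≤ M := by positivity
  have hwM : ∀ r ∈ Ioo 0 r₀, |w r| ≤ M := fun r hr => (hA r hr).trans (by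
    have := Real.sqrt_le_sqrt hr.2.le
    exact mul_le_mul_of_nonneg_left this hA0)
  set q : ℝ → ℝ := fun r => r * (1 + w r ^2) ^ (-(5/4) : ℝ) * deriv w r with hq
  have hqd : ∀ r ∈ Ioo 0 r₀, HasDerivAt q ((1 + w r ^2) ^ (-(5/4) : ℝ) *
      ((w r + w r ^3 * (3 + w r ^2) / 2) / r + S r)) r := by
    intro r hr
    have hr0 := hr.1
    have hp : 0 < 1 + w r ^ 2 := by positivity
    have h1 := ((((hw1 r hr).fun_pow 2).const_add 1).rpow_const (p := (-(5/4) : ℝ)) (Or.inl hp.ne'))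
    have h2 := ((hasDerivAt_id r).mul h1).mul (hw2 r hr)
    refine h2.congr_deriv ?_
    rw [hE r hr, Real.rpow_sub_one hp.ne']
    simp only [id, Pi.mul_apply]
    generalize (1 + w r ^2) ^ (-(5/4) : ℝ) = φ
    field_simp
    push_cast
    ring
  set B := A + A * M^2 * (3 + M^2) / 2 + K * √r₀ with hB
  have hB0 : 0 ≤ B := by positivity
  have hqb : ∀ r ∈ Ioo 0 r₀, |(1 + w r ^2) ^ (-(5/4) : ℝ) *
      ((w r + w r ^3 * (3 + w r ^2) / 2) / r + S r)| ≤ B / √r := by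
    intro r hr
    have hr0 := hr.1
    have hs : 0 < √r := Real.sqrt_pos.2 hr0
    have hφ : |(1 + w r ^2) ^ (-(5/4) : ℝ)| ≤ 1 := by
      rw [abs_of_pos (by positivity)]
      exact Real.rpow_le_one_of_one_le_of_nonpos (by nlinarith [sq_nonneg (w r)]) (by norm_num)
    have hw2M : w r ^ 2 ≤ M^2 := by
      rw [← sq_abs]; gcongr; exact hwM r hr
    have h1 : |w r + w r ^3 * (3 + w r ^2) / 2| ≤ (A + A * M^2 * (3 + M^2) / 2) * √r := by
      have e : w r + w r ^3 * (3 + w r ^2) / 2 = w r * (1 + w r^2 * (3 + w r ^2) / 2) := by ring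
      rw [e, abs_mul, abs_of_pos (a := 1 + w r^2 * (3 + w r ^2) / 2) (by positivity)]
      calc _ ≤ (A * √r) * (1 + M^2 * (3 + M^2)/2) := by
            gcongr
            exact hA r hr
        _ = _ := by ring
    rw [abs_mul]
    calc _ ≤ 1 * |(w r + w r ^3 * (3 + w r ^2) / 2) / r + S r| := by gcongr
      _ ≤ |w r + w r ^3 * (3 + w r ^2) / 2| / r + |S r| := by
          rw [one_mul]; refine (abs_add_le _ _).trans ?_
          rw [abs_div, abs_of_pos hr0]
      _ ≤ (A + A * M^2 * (3 + M^2) / 2) * √r / r + K * (√r₀ / √r) := by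
          have h3 : K ≤ K * (√r₀ / √r) := by
            apply le_mul_of_one_le_right hK0
            rw [one_le_div hs]; exact Real.sqrt_le_sqrt hr.2.le
          have := (hS r hr).trans h3
          gcongr
      _ = B / √r := by
          have : r = √r * √r := (Real.mul_self_sqrt hr0.le).symm
          generalize √r = s at *
          subst this
          rw [hB]
          field_simp
  set c := (1 + M^2) ^ (-(5/4) : ℝ) with hc
  have hc0 : 0 < c := by positivity
  refine ⟨(6 * A + B) / c, by positivity, ?_⟩
  intro r hr
  have hr0 : 0 < r := hr.1
  have hs : 0 < √r := Real.sqrt_pos.2 hr0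
  have hsub : ∀ y ∈ Icc r (2*r), y ∈ Ioo 0 r₀ := fun y hy =>
    ⟨by linarith [hy.1], by linarith [hy.2, hr.2]⟩
  obtain ⟨x, hx, hxe⟩ := exists_hasDerivAt_eq_slope w (deriv w) (show r < 2 * r by linarith)
    (fun y hy => (hw1 y (hsub y hy)).continuousAt.continuousWithinAt)
    (fun y hy => hw1 y (hsub y ⟨hy.1.le, hy.2.le⟩))
  obtain ⟨z, hz, hze⟩ := exists_hasDerivAt_eq_slope q _ (show r < x from hx.1)
    (fun y hy => (hqd y (hsub y ⟨hy.1, hy.2.trans hx.2.le⟩)).continuousAt.continuousWithinAt)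
    (fun y hy => hqd y (hsub y ⟨hy.1.le, hy.2.le.trans hx.2.le⟩))
  have hrI := hsub r ⟨le_rfl, by linarith⟩
  have h2rI := hsub (2*r) ⟨by linarith, le_rfl⟩
  have hxI := hsub x ⟨hx.1.le, hx.2.le⟩
  have hzI := hsub z ⟨hz.1.le, hz.2.le.trans hx.2.le⟩
  have hqx : |q x| ≤ 6 * A * √r := by
    have h1 : |w (2*r) - w r| ≤ 3 * A * √r := by
      have e1 := hA r hrI
      have e2 := hA (2*r) h2rI
      have e3 : √(2*r) ≤ 2 * √r := by
        rw [Real.sqrt_le_left (by positivity), mul_pow, Real.sq_sqrt hr0.le]; linarith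
      have e4 : A * √(2*r) ≤ A * (2 * √r) := by gcongr
      have := abs_sub (w (2*r)) (w r)
      linarith
    have hφ : |(1 + w x ^2) ^ (-(5/4) : ℝ)| ≤ 1 := by
      rw [abs_of_pos (by positivity)]
      exact Real.rpow_le_one_of_one_le_of_nonpos (by nlinarith [sq_nonneg (w x)]) (by norm_num)
    have h2 : |deriv w x| ≤ 3 * A * √r / r := by
      rw [hxe, abs_div, show 2 * r - r = r by ring, abs_of_pos hr0]; gcongr
    simp only [hq]
    rw [abs_mul, abs_mul, abs_of_pos hxI.1]
    calc _ ≤ (2 * r) * 1 * (3 * A * √r / r) := by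
          have := hx.2.le
          gcongr
      _ = _ := by field_simp; ring
  have hqr : |q r - q x| ≤ B * √r := by
    have h1 := hqb z hzI
    rw [hze, abs_div, abs_of_pos (by linarith [hx.1] : 0 < x - r), div_le_iff₀ (by linarith [hx.1])] at h1
    rw [abs_sub_comm]
    refine h1.trans ?_
    have h3 : √r ≤ √z := Real.sqrt_le_sqrt hz.1.le
    calc B / √z * (x - r) ≤ B / √r * r := by
          have : x - r ≤ r := by linarith [hx.2]
          have : 0 ≤ x - r := by linarith [hx.1]
          gcongr
      _ = B * √r := by
          have : r = √r * √r := (Real.mul_self_sqrt hr0.le).symm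
          generalize √r = s at *
          subst this
          field_simp
  have hq2 : |q r| ≤ (6 * A + B) * √r := by
    have := abs_sub_abs_le_abs_sub (q r) (q x)
    linarith
  have hcφ : c ≤ (1 + w r ^2) ^ (-(5/4) : ℝ) := by
    apply Real.rpow_le_rpow_of_nonpos (by positivity) _ (by norm_num)
    have : w r ^ 2 ≤ M^2 := by
      rw [← sq_abs]; gcongr; exact hwM r hrI
    linarith
  have h4 : r * c * |deriv w r| ≤ |q r| := by
    simp only [hq]
    rw [abs_mul, abs_mul, abs_of_pos hr0, abs_of_pos (a := (1 + w r ^2) ^ (-(5/4) : ℝ)) (by positivity)]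
    gcongr
  have h5 := h4.trans hq2
  rw [div_div, le_div_iff₀ (by positivity)]
  have : r = √r * √r := (Real.mul_self_sqrt hr0.le).symm
  have h6 : √r * (|deriv w r| * (c * √r)) ≤ √r * (6 * A + B) := by
    calc _ = (√r * √r) * c * |deriv w r| := by ring
      _ ≤ _ := by rw [← this]; linarith
  exact le_of_mul_le_mul_left h6 hs

lemma sa_tendsto (H H' : ℝ → ℝ) (r₁ C : ℝ) (hr₁ : 0 < r₁) (hC : 0 ≤ C)
    (hH : ∀ r ∈ Ioo 0 r₁, HasDerivAt H (H' r) r)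
    (hb : ∀ r ∈ Ioo 0 r₁, |H' r| ≤ C / √r) : ∃ L, Tendsto H (𝓝[>] 0) (𝓝 L) := by
  have hd : ∀ σ : ℝ, ∀ r ∈ Ioo 0 r₁, HasDerivAt (fun r => σ * H r + 2 * C * √r)
      (σ * H' r + C / √r) r := by
    intro σ r hr
    refine (((hH r hr).const_mul σ).add ((Real.hasDerivAt_sqrt hr.1.ne').const_mul (2 * C))).congr_deriv ?_
    have : 0 < √r := Real.sqrt_pos.2 hr.1
    field_simp
  have hmono : ∀ σ : ℝ, |σ| = 1 → MonotoneOn (fun r => σ * H r + 2 * C * √r) (Ioo 0 r₁) := by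
    intro σ hσ
    apply monotoneOn_of_deriv_nonneg (convex_Ioo _ _)
    · exact fun r hr => (hd σ r hr).continuousAt.continuousWithinAt
    · rw [interior_Ioo]
      exact fun r hr => (hd σ r hr).differentiableAt.differentiableWithinAt
    · rw [interior_Ioo]
      intro r hr
      rw [(hd σ r hr).deriv]
      have h1 : |σ * H' r| ≤ C / √r := by rw [abs_mul, hσ, one_mul]; exact hb r hr
      linarith [neg_abs_le (σ * H' r)]
  have hm1 := hmono 1 (by simp)
  have hm2 := hmono (-1) (by simp)
  have hmid : r₁/2 ∈ Ioo 0 r₁ := ⟨by linarith, by linarith⟩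
  have hbdd : BddBelow ((fun r => 1 * H r + 2 * C * √r) '' Ioo 0 r₁) := by
    refine ⟨H (r₁/2) - 2 * C * √(r₁/2), ?_⟩
    rintro _ ⟨r, hr, rfl⟩
    rcases le_total r (r₁/2) with h | h
    · have := hm2 hr hmid h
      simp only at this ⊢
      have h3 : 0 ≤ C * √r := by positivity
      linarith
    · have := hm1 hmid hr h
      simp only at this ⊢
      have h3 : 0 ≤ C * √(r₁/2) := by positivity
      linarith
  have ht := hm1.tendsto_nhdsWithin_Ioo_right ⟨_, hmid⟩ hbdd
  have hs : Tendsto (fun r => 2 * C * √r) (𝓝[>] 0) (𝓝 (2 * C * √0)) :=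
    ((continuous_const.mul Real.continuous_sqrt).tendsto 0).mono_left nhdsWithin_le_nhds
  refine ⟨_, (ht.sub hs).congr ?_⟩
  intro r; ring

lemma sa_core (w S : ℝ → ℝ) (r₀ A K lam : ℝ) (hr₀ : 0 < r₀)
    (hA0 : 0 ≤ A) (hK0 : 0 ≤ K)
    (hw1 : ∀ r ∈ Ioo 0 r₀, HasDerivAt w (deriv w r) r)
    (hw2 : ∀ r ∈ Ioo 0 r₀, HasDerivAt (deriv w) (deriv (deriv w) r) r)
    (hwt : Tendsto w (𝓝[>] 0) (𝓝 0))
    (hA : ∀ r ∈ Ioo 0 r₀, |w r| ≤ A * √r)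
    (hS : ∀ r ∈ Ioo 0 r₀, |S r| ≤ K)
    (hS2 : ∀ r ∈ Ioo 0 r₀, |S r - lam| ≤ K * √r)
    (hE : ∀ r ∈ Ioo 0 r₀, deriv (deriv w) r = - deriv w r / r + w r / r^2
      + 5 * w r / (2 * (1 + w r ^2)) * deriv w r ^ 2 + w r ^3 / (2 * r^2) * (3 + w r ^2)
      + S r / r) :
    ∃ L, Tendsto (fun r => deriv w r - (1/2) * lam * Real.log r) (𝓝[>] 0) (𝓝 L) := by
  obtain ⟨C, hC0, hC⟩ := sa_dbound w S r₀ A K hr₀ hA0 hK0 hw1 hw2 hA hS hE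
  set M := A * √r₀ with hM
  have hM0 : 0 ≤ M := by positivity
  have hwM : ∀ r ∈ Ioo 0 r₀, |w r| ≤ M := fun r hr => (hA r hr).trans (by
    have := Real.sqrt_le_sqrt hr.2.le
    exact mul_le_mul_of_nonneg_left this hA0)
  have hsub : ∀ r ∈ Ioo 0 (r₀/2), r ∈ Ioo 0 r₀ := fun r hr => ⟨hr.1, by linarith [hr.2]⟩
  set H : ℝ → ℝ := fun r => deriv w r + w r / r - lam * Real.log r with hH
  obtain ⟨L, hL⟩ := sa_tendsto H (fun r => 5 * w r / (2 * (1 + w r ^2)) * deriv w r ^ 2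
      + w r ^3 / (2 * r^2) * (3 + w r ^2) + (S r - lam) / r) (r₀/2)
      (5/2 * A * C^2 + A^3 / 2 * (3 + M^2) + K) (by linarith) (by positivity) (by
        intro r hr
        have hr0 := hr.1
        have h := ((hw2 r (hsub r hr)).add ((hw1 r (hsub r hr)).div (hasDerivAt_id r) hr0.ne')).sub
          ((Real.hasDerivAt_log hr0.ne').const_mul lam)
        refine h.congr_deriv ?_
        rw [hE r (hsub r hr)]
        simp only [id]
        field_simp
        ring) (by
        intro r hr
        have hr0 := hr.1
        have hs : 0 < √r := Real.sqrt_pos.2 hr0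
        have hrI := hsub r hr
        have hw2M : w r ^ 2 ≤ M^2 := by
          rw [← sq_abs]; gcongr; exact hwM r hrI
        have e : r = √r * √r := (Real.mul_self_sqrt hr0.le).symm
        have b1 : |5 * w r / (2 * (1 + w r ^2)) * deriv w r ^ 2| ≤ 5/2 * A * C^2 / √r := by
          rw [abs_mul, abs_div, abs_mul, abs_pow, abs_of_pos (a := 2 * (1 + w r ^2)) (by positivity),
            abs_of_pos (a := (5:ℝ)) (by norm_num)]
          calc _ ≤ 5 * (A * √r) / (2 * (1 + 0)) * (C / √r)^2 := by
                gcongr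
                · exact hA r hrI
                · positivity
                · exact hC r hr
            _ = _ := by field_simp; try norm_num
        have b2 : |w r ^3 / (2 * r^2) * (3 + w r ^2)| ≤ A^3 / 2 * (3 + M^2) / √r := by
          rw [abs_mul, abs_div, abs_pow, abs_of_pos (a := 2 * r^2) (by positivity),
            abs_of_pos (a := 3 + w r ^2) (by positivity)]
          calc _ ≤ (A * √r)^3 / (2 * r^2) * (3 + M^2) := by
                gcongr
                exact hA r hrI
            _ = _ := by
                generalize √r = s at *
                subst e
                field_simp
        have b3 : |(S r - lam) / r| ≤ K / √r := by
          rw [abs_div, abs_of_pos hr0]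
          calc _ ≤ K * √r / r := by gcongr; exact hS2 r hrI
            _ = _ := by
                generalize √r = s at *
                subst e
                field_simp
        refine (abs_add_three _ _ _).trans ?_
        rw [add_div, add_div]
        linarith)
  -- l'Hôpital
  have hid : Tendsto (fun r : ℝ => r) (𝓝[>] 0) (𝓝 0) := tendsto_id.mono_left nhdsWithin_le_nhds
  have hml : Tendsto (fun r => r * Real.log r) (𝓝[>] 0) (𝓝 0) := by
    have := (Real.continuous_mul_log.tendsto 0).mono_left (nhdsWithin_le_nhds (s := Ioi 0))
    simpa using this
  have hev : ∀ᶠ r in 𝓝[>] (0:ℝ), r ∈ Ioo 0 r₀ := Ioo_mem_nhdsGT hr₀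
  have hlh : Tendsto (fun r => (r * (w r - 1/2 * lam * (r * Real.log r))) / r^2) (𝓝[>] 0)
      (𝓝 ((L - lam/2)/2)) := by
    apply HasDerivAt.lhopital_zero_nhdsGT (f' := fun r => r * (H r - lam / 2)) (g' := fun r => 2 * r)
    · filter_upwards [hev] with r hr
      have hr0 := hr.1
      have h := (hasDerivAt_id r).mul ((hw1 r hr).sub ((Real.hasDerivAt_mul_log hr0.ne').const_mul (1/2*lam)))
      refine h.congr_deriv ?_
      simp only [id, hH, Pi.sub_apply]
      field_simp
      ring
    · filter_upwards with r
      simpa using hasDerivAt_pow 2 r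
    · filter_upwards [hev] with r hr
      have := hr.1
      positivity
    · simpa using hid.mul (hwt.sub (hml.const_mul (1/2*lam)))
    · simpa using hid.pow 2
    · refine ((hL.sub_const (lam/2)).div_const 2).congr' ?_
      filter_upwards [hev] with r hr
      have := hr.1
      field_simp
  refine ⟨_, (hL.sub hlh).congr' ?_⟩
  filter_upwards [hev] with r hr
  have := hr.1
  simp only [hH]
  field_simp
  ring

lemma sa_final (w : ℝ → ℝ) (r₀ lam L : ℝ) (hr₀ : 0 < r₀)
    (hwc : ContinuousOn w (Icc 0 r₀)) (hws : ContDiffOn ℝ 1 w (Ioc 0 r₀))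
    (hL : Tendsto (fun r => deriv w r - (1/2) * lam * Real.log r) (𝓝[>] 0) (𝓝 L)) :
    (∃ ξ : ℝ → ℝ, ContDiffOn ℝ 1 ξ (Set.Icc 0 r₀) ∧
      ∀ r ∈ Set.Ioc (0:ℝ) r₀, w r = (1/2) * lam * r * Real.log r + ξ r) ∧
    (∀ α ∈ Set.Ioo (0:ℝ) 1, ∃ C : ℝ, ∀ r ∈ Set.Icc (0:ℝ) r₀, ∀ r' ∈ Set.Icc (0:ℝ) r₀,
      |w r - w r'| ≤ C * |r - r'| ^ α) ∧
    (∀ p : ℝ, 1 ≤ p →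
      MeasureTheory.IntegrableOn
        (fun r => |deriv w r| ^ p) (Set.Ioo (0:ℝ) r₀)) := by
  set ξ : ℝ → ℝ := fun r => w r - 1/2 * lam * (r * Real.log r) with hξ
  have hξc : ContinuousOn ξ (Icc 0 r₀) :=
    hwc.sub (Real.continuous_mul_log.continuousOn.const_smul (1/2*lam))
  have hξs : ContDiffOn ℝ 1 ξ (Ioc 0 r₀) := by
    apply hws.sub
    apply contDiffOn_const.mul
    apply contDiffOn_id.mul
    exact contDiffOn_id.log (fun x hx => hx.1.ne')
  have hwd : ∀ r ∈ Ioo 0 r₀, HasDerivAt w (deriv w r) r := fun r hr =>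
    ((hws.contDiffAt (Ioc_mem_nhds hr.1 hr.2)).differentiableAt (by norm_num)).hasDerivAt
  have hξd : ∀ r ∈ Ioo 0 r₀, HasDerivAt ξ (deriv w r - 1/2 * lam * (Real.log r + 1)) r := fun r hr =>
    (hwd r hr).sub ((Real.hasDerivAt_mul_log hr.1.ne').const_mul (1/2*lam))
  have hev : ∀ᶠ r in 𝓝[>] (0:ℝ), r ∈ Ioo 0 r₀ := Ioo_mem_nhdsGT hr₀
  have hξt : Tendsto (deriv ξ) (𝓝[>] 0) (𝓝 (L - 1/2*lam)) := by
    refine (hL.sub_const (1/2*lam)).congr' ?_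
    filter_upwards [hev] with r hr
    rw [(hξd r hr).deriv]; ring
  have h0 : HasDerivWithinAt ξ (L - 1/2*lam) (Icc 0 r₀) 0 := by
    refine (hasDerivWithinAt_Ici_of_tendsto_deriv (s := Ioo 0 r₀) ?_ ?_ hev hξt).mono Icc_subset_Ici_self
    · exact fun r hr => (hξd r hr).differentiableAt.differentiableWithinAt
    · exact (hξc 0 ⟨le_rfl, hr₀.le⟩).mono Ioo_subset_Icc_self
  have hud := uniqueDiffOn_Icc hr₀
  have hξ1 : ContDiffOn ℝ 1 ξ (Icc 0 r₀) := by
    rw [contDiffOn_one_iff_derivWithin hud]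
    have hset : ∀ r ∈ Ioc 0 r₀, Icc 0 r₀ =ᶠ[𝓝 r] Ioc 0 r₀ := by
      intro r hr
      filter_upwards [Ioi_mem_nhds hr.1] with y hy
      apply propext
      exact ⟨fun h => ⟨hy, h.2⟩, fun h => ⟨h.1.le, h.2⟩⟩
    constructor
    · intro r hr
      rcases hr.1.eq_or_lt with rfl | hpos
      · exact h0.differentiableWithinAt
      · have := (hξs.differentiableOn (by norm_num)) r ⟨hpos, hr.2⟩
        exact (differentiableWithinAt_congr_set (hset r ⟨hpos, hr.2⟩)).2 this
    · intro r hr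
      rcases hr.1.eq_or_lt with rfl | hpos
      · have : ContinuousWithinAt (derivWithin ξ (Icc 0 r₀)) (Ioi 0) 0 := by
          unfold ContinuousWithinAt
          rw [h0.derivWithin (hud 0 hr)]
          refine hξt.congr' ?_
          filter_upwards [hev] with r hr
          rw [derivWithin_of_mem_nhds (Icc_mem_nhds hr.1 hr.2)]
        exact (continuousWithinAt_Ioi_iff_Ici.1 this).mono Icc_subset_Ici_self
      · have hrI : r ∈ Ioc 0 r₀ := ⟨hpos, hr.2⟩
        have h1 := (hξs.continuousOn_derivWithin (uniqueDiffOn_Ioc 0 r₀) le_rfl) r hrI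
        have h2 := (continuousWithinAt_congr_set (hset r hrI)).2 h1
        refine h2.congr_of_eventuallyEq ?_ (derivWithin_congr_set (hset r hrI))
        apply Filter.Eventually.filter_mono nhdsWithin_le_nhds
        filter_upwards [(hset r hrI).eventuallyEq_nhds] with y hy
        exact derivWithin_congr_set hy
  have hbound : ∀ β : ℝ, 0 < β → ∃ C, 0 ≤ C ∧ ∀ r ∈ Ioo 0 r₀, |deriv w r| ≤ C * r ^ (-β) := by
    intro β hβ
    obtain ⟨D, hD⟩ := isCompact_Icc.exists_bound_of_continuousOn (hξ1.continuousOn_derivWithin hud le_rfl)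
    have hD0 : 0 ≤ D := (norm_nonneg _).trans (hD 0 ⟨le_rfl, hr₀.le⟩)
    refine ⟨(D + |1/2*lam| * (|Real.log r₀| + 1)) * r₀ ^ β + |1/2*lam| * (1/β), by positivity, ?_⟩
    intro r hr
    have hr0 := hr.1
    have h1 : |deriv w r - 1/2 * lam * (Real.log r + 1)| ≤ D := by
      have := hD r ⟨hr.1.le, hr.2.le⟩
      rwa [derivWithin_of_mem_nhds (Icc_mem_nhds hr.1 hr.2), (hξd r hr).deriv] at this
    have h2 : |Real.log r| ≤ |Real.log r₀| + 1/β * r ^ (-β) := by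
      have hp : 0 < 1/β * r ^ (-β) := by positivity
      rw [abs_le]
      constructor
      · have := Real.log_le_rpow_div (inv_nonneg.2 hr0.le) hβ
        rw [Real.log_inv, Real.inv_rpow hr0.le, ← Real.rpow_neg hr0.le] at this
        have h3 : r ^ (-β) / β = 1/β * r ^ (-β) := by ring
        linarith [abs_nonneg (Real.log r₀)]
      · linarith [Real.log_le_log hr0 hr.2.le, le_abs_self (Real.log r₀)]
    have h3 : 1 ≤ r₀ ^ β * r ^ (-β) := by
      rw [Real.rpow_neg hr0.le, ← div_eq_mul_inv, one_le_div (by positivity)]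
      exact Real.rpow_le_rpow hr0.le hr.2.le hβ.le
    have h4 : |deriv w r| ≤ D + |1/2*lam| * (|Real.log r| + 1) := by
      have e : deriv w r = (deriv w r - 1/2 * lam * (Real.log r + 1)) + 1/2*lam * (Real.log r + 1) := by ring
      rw [e]
      refine (abs_add_le _ _).trans ?_
      rw [abs_mul (1/2*lam)]
      have : |Real.log r + 1| ≤ |Real.log r| + 1 := by
        simpa using abs_add_le (Real.log r) 1
      gcongr
    calc |deriv w r| ≤ D + |1/2*lam| * ((|Real.log r₀| + 1/β * r ^ (-β)) + 1) := by
          refine h4.trans ?_; gcongr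
      _ = (D + |1/2*lam| * (|Real.log r₀| + 1)) * 1 + |1/2*lam| * (1/β) * r ^ (-β) := by ring
      _ ≤ (D + |1/2*lam| * (|Real.log r₀| + 1)) * (r₀ ^ β * r ^ (-β)) + |1/2*lam| * (1/β) * r ^ (-β) := by
          gcongr
      _ = _ := by ring
  refine ⟨⟨ξ, hξ1, ?_⟩, ?_, ?_⟩
  · intro r hr
    simp only [hξ]; ring
  · intro α hα
    have hα0 := hα.1
    obtain ⟨C, hC0, hC⟩ := hbound (1 - α) (by linarith [hα.2])
    have hd : ∀ σ : ℝ, ∀ r ∈ Ioo 0 r₀, HasDerivAt (fun r => σ * w r + C / α * r ^ α)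
        (σ * deriv w r + C * r ^ (-(1 - α))) r := by
      intro σ r hr
      refine (((hwd r hr).const_mul σ).add
        ((Real.hasDerivAt_rpow_const (p := α) (Or.inl hr.1.ne')).const_mul (C/α))).congr_deriv ?_
      rw [show -(1 - α) = α - 1 by ring]
      field_simp
    have hmono : ∀ σ : ℝ, |σ| = 1 → MonotoneOn (fun r => σ * w r + C / α * r ^ α) (Icc 0 r₀) := by
      intro σ hσ
      apply monotoneOn_of_deriv_nonneg (convex_Icc _ _)
      · exact (continuousOn_const.mul hwc).add (continuousOn_const.mul
          (Real.continuous_rpow_const hα0.le).continuousOn)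
      · rw [interior_Icc]
        exact fun r hr => (hd σ r hr).differentiableAt.differentiableWithinAt
      · rw [interior_Icc]
        intro r hr
        rw [(hd σ r hr).deriv]
        have h1 : |σ * deriv w r| ≤ C * r ^ (-(1 - α)) := by
          rw [abs_mul, hσ, one_mul]; exact hC r hr
        linarith [neg_abs_le (σ * deriv w r)]
    have hm1 := hmono 1 (by simp)
    have hm2 := hmono (-1) (by simp)
    have key : ∀ r ∈ Icc 0 r₀, ∀ r' ∈ Icc 0 r₀, r ≤ r' → |w r - w r'| ≤ C / α * |r - r'| ^ α := by
      intro r hr r' hr' h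
      have e1 := hm1 hr hr' h
      have e2 := hm2 hr hr' h
      simp only at e1 e2
      have e3 : r' ^ α ≤ r ^ α + (r' - r) ^ α := by
        have := Real.rpow_add_le_add_rpow hr.1 (sub_nonneg.2 h) hα0.le hα.2.le
        simpa using this
      have e4 : C / α * r' ^ α ≤ C / α * (r ^ α + (r' - r) ^ α) := by gcongr
      rw [abs_sub_comm r r', abs_of_nonneg (sub_nonneg.2 h), abs_le]
      constructor <;> linarith
    refine ⟨C / α, ?_⟩
    intro r hr r' hr'
    rcases le_total r r' with h | h
    · exact key r hr r' hr' h
    · rw [abs_sub_comm, abs_sub_comm r r']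
      exact key r' hr' r hr h
  · intro p hp
    have hp0 : 0 < p := by linarith
    obtain ⟨C, hC0, hC⟩ := hbound (1 / (2 * p)) (by positivity)
    have hint : IntegrableOn (fun r : ℝ => C ^ p * r ^ (-(1/2) : ℝ)) (Ioo 0 r₀) := by
      apply Integrable.const_mul
      have := intervalIntegral.intervalIntegrable_rpow' (a := 0) (b := r₀) (r := -(1/2)) (by norm_num)
      rw [intervalIntegrable_iff_integrableOn_Ioo_of_le hr₀.le] at this
      exact this
    refine Integrable.mono' hint ?_ ?_
    · exact (((measurable_deriv w).abs).pow_const p).aestronglyMeasurable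
    · refine (ae_restrict_iff' measurableSet_Ioo).2 (Eventually.of_forall ?_)
      intro r hr
      rw [Real.norm_of_nonneg (by positivity)]
      calc |deriv w r| ^ p ≤ (C * r ^ (-(1/(2*p)))) ^ p := by
            gcongr; exact hC r hr
        _ = C ^ p * r ^ (-(1/2) : ℝ) := by
            rw [Real.mul_rpow hC0 (Real.rpow_nonneg hr.1.le _), ← Real.rpow_mul hr.1.le]
            congr 2
            field_simp

lemma sa_S (w : ℝ → ℝ) (r₀ a b lam A : ℝ) (hr₀ : 0 < r₀) (hA0 : 0 ≤ A)
    (hA : ∀ r ∈ Ioo 0 r₀, |w r| ≤ A * √r) (S : ℝ → ℝ)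
    (hS : ∀ r, S r = (1/2) * (√(1 + w r ^ 2)) ^ 5 * a * r ^ 2
      + b * (√(1 + w r ^ 2)) ^ 4 * w r * r + lam * (√(1 + w r ^ 2)) ^ 5) :
    ∃ K, 0 ≤ K ∧ ∀ r ∈ Ioo 0 r₀, |S r - lam| ≤ K * √r := by
  set M := A * √r₀ with hM
  have hM0 : 0 ≤ M := by positivity
  have hwM : ∀ r ∈ Ioo 0 r₀, |w r| ≤ M := fun r hr => (hA r hr).trans (by
    have := Real.sqrt_le_sqrt hr.2.le
    exact mul_le_mul_of_nonneg_left this hA0)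
  set V := √(1 + M^2) with hV
  have hV0 : 0 ≤ V := by positivity
  refine ⟨1/2 * V^5 * |a| * (r₀ * √r₀) + |b| * V^4 * A * r₀ + |lam| * (5 * V^4 * M * A), by positivity, ?_⟩
  intro r hr
  have hr0 := hr.1
  have hs : 0 < √r := Real.sqrt_pos.2 hr0
  have hss := Real.sqrt_le_sqrt hr.2.le
  have hw2M : w r ^ 2 ≤ M^2 := by
    rw [← sq_abs]; gcongr; exact hwM r hr
  have hvsq : √(1 + w r ^ 2) ^ 2 = 1 + w r ^ 2 := Real.sq_sqrt (by positivity)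
  have hv1 : 1 ≤ √(1 + w r ^ 2) := by
    rw [Real.one_le_sqrt]; nlinarith [sq_nonneg (w r)]
  have hvV : √(1 + w r ^ 2) ≤ V := Real.sqrt_le_sqrt (by linarith)
  rw [hS]
  generalize √(1 + w r ^ 2) = v at *
  have hV1 : 1 ≤ V := hv1.trans hvV
  have e : r = √r * √r := (Real.mul_self_sqrt hr0.le).symm
  have c1 : |1/2 * v^5 * a * r^2| ≤ 1/2 * V^5 * |a| * (r₀ * √r₀) * √r := by
    rw [abs_mul, abs_mul, abs_of_pos (a := r^2) (by positivity), abs_of_pos (a := 1/2 * v^5) (by positivity)]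
    have : r^2 ≤ r₀ * √r₀ * √r := by
      calc r^2 = r * (√r * √r) := by rw [← e]; ring
        _ ≤ r₀ * (√r₀ * √r) := by
          have := hr.2.le
          gcongr
        _ = _ := by ring
    calc _ ≤ 1/2 * V^5 * |a| * (r₀ * √r₀ * √r) := by gcongr
      _ = _ := by ring
  have c2 : |b * v^4 * w r * r| ≤ |b| * V^4 * A * r₀ * √r := by
    rw [abs_mul, abs_mul, abs_mul, abs_of_pos hr0, abs_of_pos (a := v^4) (by positivity)]
    calc _ ≤ |b| * V^4 * (A * √r) * r₀ := by
          have := hr.2.le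
          have := hA r hr
          gcongr
      _ = _ := by ring
  have c3 : |lam * v^5 - lam| ≤ |lam| * (5 * V^4 * M * A) * √r := by
    have : lam * v^5 - lam = lam * ((v - 1) * (v^4 + v^3 + v^2 + v + 1)) := by ring
    rw [this, abs_mul, abs_of_nonneg (a := (v - 1) * (v^4 + v^3 + v^2 + v + 1))
      (mul_nonneg (by linarith) (by positivity)), mul_assoc]
    apply mul_le_mul_of_nonneg_left _ (abs_nonneg _)
    have d1 : v - 1 ≤ M * (A * √r) := by
      calc v - 1 ≤ w r ^2 := by nlinarith
        _ = |w r| * |w r| := by rw [← sq_abs]; ring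
        _ ≤ _ := by
          have := hA r hr
          have := hwM r hr
          gcongr
    have d2 : v^4 + v^3 + v^2 + v + 1 ≤ 5 * V^4 := by
      have f3 : v^3 ≤ v^4 := pow_le_pow_right₀ hv1 (by norm_num)
      have f2 : v^2 ≤ v^4 := pow_le_pow_right₀ hv1 (by norm_num)
      have f1 : v ≤ v^4 := le_self_pow₀ hv1 (by norm_num)
      have f0 : 1 ≤ v^4 := one_le_pow₀ hv1
      have f4 : v^4 ≤ V^4 := by gcongr
      linarith
    calc _ ≤ (M * (A * √r)) * (5 * V^4) := by gcongr
      _ = _ := by ring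
  rw [add_sub_assoc]
  refine (abs_add_three _ _ _).trans ?_
  linarith

lemma sa_main (r₀ a b lam : ℝ) (hr₀ : 0 < r₀) (w : ℝ → ℝ)
    (hwc : ContinuousOn w (Icc 0 r₀))
    (hws : ContDiffOn ℝ 2 w (Ioc 0 r₀))
    (hw0 : w 0 = 0)
    (hode : ∀ r ∈ Set.Ioo (0:ℝ) r₀,
      deriv (deriv w) r + deriv (fun s => w s / s) r
        - ((5 * w r / (2 * (1 + (w r) ^ 2)))
              * (deriv w r) ^ 2
            + ((w r) ^ 3 / (2 * r ^ 2)) * (3 + (w r) ^ 2))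
        = (1/2) * (Real.sqrt (1 + (w r) ^ 2)) ^ 5 * a * r
          + b * (Real.sqrt (1 + (w r) ^ 2)) ^ 4 * w r
          + (lam / r) * (Real.sqrt (1 + (w r) ^ 2)) ^ 5) :
    ∃ L, Tendsto (fun r => deriv w r - (1/2) * lam * Real.log r) (𝓝[>] 0) (𝓝 L) := by
  have hc2 : ∀ r ∈ Ioo 0 r₀, ContDiffAt ℝ 2 w r := fun r hr =>
    hws.contDiffAt (Ioc_mem_nhds hr.1 hr.2)
  have hw1 : ∀ r ∈ Ioo 0 r₀, HasDerivAt w (deriv w r) r := fun r hr =>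
    ((hc2 r hr).differentiableAt (by norm_num)).hasDerivAt
  have hw2 : ∀ r ∈ Ioo 0 r₀, HasDerivAt (deriv w) (deriv (deriv w) r) r := fun r hr => by
    have h2 : ContDiffAt ℝ 1 (deriv w) r :=
      ((hc2 r hr).fderiv_right (m := 1) (by norm_num)).clm_apply (contDiffAt_const (c := (1:ℝ)))
    exact (h2.differentiableAt (by norm_num)).hasDerivAt
  set S : ℝ → ℝ := fun r => (1/2) * (√(1 + w r ^ 2)) ^ 5 * a * r ^ 2
      + b * (√(1 + w r ^ 2)) ^ 4 * w r * r + lam * (√(1 + w r ^ 2)) ^ 5 with hSdef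
  have hE : ∀ r ∈ Ioo 0 r₀, deriv (deriv w) r = - deriv w r / r + w r / r^2
      + 5 * w r / (2 * (1 + w r ^2)) * deriv w r ^ 2 + w r ^3 / (2 * r^2) * (3 + w r ^2)
      + S r / r := by
    intro r hr
    have h := hode r hr
    have hr0 := hr.1
    have hd : deriv (fun s => w s / s) r = deriv w r / r - w r / r^2 := by
      have := ((hw1 r hr).div (hasDerivAt_id r) hr0.ne').deriv
      have e : deriv (fun s => w s / s) r = _ := this
      rw [e]
      simp only [id]
      field_simp
    rw [hd] at h
    have hSr : S r / r = (1/2) * (Real.sqrt (1 + (w r) ^ 2)) ^ 5 * a * r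
          + b * (Real.sqrt (1 + (w r) ^ 2)) ^ 4 * w r
          + (lam / r) * (Real.sqrt (1 + (w r) ^ 2)) ^ 5 := by
      simp only [hSdef]
      generalize √(1 + w r ^ 2) = v
      field_simp
    rw [hSr, ← h]
    ring
  have hSc : ContinuousOn S (Icc 0 r₀) := by
    simp only [hSdef]
    fun_prop
  obtain ⟨K, hK⟩ := isCompact_Icc.exists_bound_of_continuousOn hSc
  have hK0 : 0 ≤ K := (norm_nonneg _).trans (hK 0 ⟨le_rfl, hr₀.le⟩)
  have hKS : ∀ r ∈ Ioo 0 r₀, |S r| ≤ K := fun r hr => hK r ⟨hr.1.le, hr.2.le⟩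
  obtain ⟨A1, hA10, hA1⟩ := sa_barrier w r₀ K hr₀ hwc hw0 hc2 (by
    intro r hr hp
    have hr0 := hr.1
    rw [hE r hr]
    have h1 : 0 ≤ 5 * w r / (2 * (1 + w r ^2)) * deriv w r ^ 2 := by positivity
    have h2 : 0 ≤ w r ^3 / (2 * r^2) * (3 + w r ^2) := by positivity
    have h3 : -K / r ≤ S r / r := by
      gcongr; linarith [neg_abs_le (S r), hKS r hr]
    have h4 : - deriv w r / r = -(deriv w r / r) := by ring
    have h5 : - K / r = -(K / r) := by ring
    linarith)
  have hdn : deriv (fun r => - w r) = fun r => - deriv w r := by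
    funext r; exact deriv.fun_neg
  obtain ⟨A2, hA20, hA2⟩ := sa_barrier (fun r => - w r) r₀ K hr₀ hwc.neg (by simp [hw0])
    (fun r hr => (hc2 r hr).neg) (by
    intro r hr hp
    have hr0 := hr.1
    have hdd : deriv (fun r => - deriv w r) r = - deriv (deriv w) r := deriv.fun_neg
    rw [hdn, hdd, hE r hr]
    simp only at hp ⊢
    have h1 : 0 ≤ 5 * (- w r) / (2 * (1 + w r ^2)) * deriv w r ^ 2 := by positivity
    have h2 : 0 ≤ (- w r) ^3 / (2 * r^2) * (3 + w r ^2) := by positivity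
    have h1' : 5 * (- w r) / (2 * (1 + w r ^2)) * deriv w r ^ 2 =
      - (5 * (w r) / (2 * (1 + w r ^2)) * deriv w r ^ 2) := by ring
    have h2' : (- w r) ^3 / (2 * r^2) * (3 + w r ^2) = -(( w r) ^3 / (2 * r^2) * (3 + w r ^2)) := by ring
    have h3 : S r / r ≤ K / r := by
      gcongr; linarith [le_abs_self (S r), hKS r hr]
    have h4 : - deriv w r / r = -(deriv w r / r) := by ring
    have h5 : - w r / r^2 = -(w r / r^2) := by ring
    linarith)
  have hA : ∀ r ∈ Ioo 0 r₀, |w r| ≤ (A1 + A2) * √r := by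
    intro r hr
    have h1 := hA1 r ⟨hr.1.le, hr.2.le⟩
    have h2 := hA2 r ⟨hr.1.le, hr.2.le⟩
    have h3 : 0 ≤ A1 * √r := by positivity
    have h4 : 0 ≤ A2 * √r := by positivity
    rw [abs_le]
    constructor <;> linarith
  obtain ⟨K2, hK20, hK2⟩ := sa_S w r₀ a b lam (A1 + A2) hr₀ (by positivity) hA S (fun r => rfl)
  have hwt : Tendsto w (𝓝[>] 0) (𝓝 0) := by
    have h := (hwc 0 ⟨le_rfl, hr₀.le⟩).mono (Ioo_subset_Icc_self)
    unfold ContinuousWithinAt at h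
    rw [hw0, nhdsWithin_Ioo_eq_nhdsGT hr₀] at h
    exact h
  refine sa_core w S r₀ (A1 + A2) (K + K2) lam hr₀ (by positivity) (by positivity) hw1 hw2 hwt hA
    (fun r hr => (hKS r hr).trans (by linarith)) (fun r hr => (hK2 r hr).trans ?_) hE
  gcongr
  linarith

end

/-- **Expansion of the slopeFn at the axis.** If `u ∈ C¹([0,r₀]) ∩ C^∞((0,r₀])` with
`u'(0) = 0` solves the once-integrated Euler–Lagrange ODE with residue `λ`, then
`u'(r) = ½ λ r ln r + ξ(r)` with `ξ ∈ C¹([0,r₀])`; in particular `u'` is `α`-Hölder on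
`[0,r₀]` for every `α ∈ (0,1)` and `u'' ∈ L^p((0,r₀))` for every `p ∈ [1,∞)`. -/
theorem slope_expansion_at_axis (r₀ a b lam : ℝ) (hr₀ : 0 < r₀) (u : ℝ → ℝ)
    (hu1 : ContDiffOn ℝ 1 u (Set.Icc 0 r₀))
    (hus : ContDiffOn ℝ (⊤ : ℕ∞) u (Set.Ioc 0 r₀))
    (hu0 : slopeFn u r₀ 0 = 0)
    (hode : ∀ r ∈ Set.Ioo (0:ℝ) r₀,
      deriv (deriv (slopeFn u r₀)) r + deriv (fun s => slopeFn u r₀ s / s) r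
        - ((5 * slopeFn u r₀ r / (2 * (1 + (slopeFn u r₀ r) ^ 2)))
              * (deriv (slopeFn u r₀) r) ^ 2
            + ((slopeFn u r₀ r) ^ 3 / (2 * r ^ 2)) * (3 + (slopeFn u r₀ r) ^ 2))
        = (1/2) * (Real.sqrt (1 + (slopeFn u r₀ r) ^ 2)) ^ 5 * a * r
          + b * (Real.sqrt (1 + (slopeFn u r₀ r) ^ 2)) ^ 4 * slopeFn u r₀ r
          + (lam / r) * (Real.sqrt (1 + (slopeFn u r₀ r) ^ 2)) ^ 5) :
    (∃ ξ : ℝ → ℝ, ContDiffOn ℝ 1 ξ (Set.Icc 0 r₀) ∧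
      ∀ r ∈ Set.Ioc (0:ℝ) r₀, slopeFn u r₀ r = (1/2) * lam * r * Real.log r + ξ r) ∧
    (∀ α ∈ Set.Ioo (0:ℝ) 1, ∃ C : ℝ, ∀ r ∈ Set.Icc (0:ℝ) r₀, ∀ r' ∈ Set.Icc (0:ℝ) r₀,
      |slopeFn u r₀ r - slopeFn u r₀ r'| ≤ C * |r - r'| ^ α) ∧
    (∀ p : ℝ, 1 ≤ p →
      MeasureTheory.IntegrableOn
        (fun r => |deriv (slopeFn u r₀) r| ^ p) (Set.Ioo (0:ℝ) r₀)) := by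
  have hws : ContDiffOn ℝ 2 (slopeFn u r₀) (Set.Ioc 0 r₀) := by
    refine (hus.derivWithin (m := 2) (uniqueDiffOn_Ioc 0 r₀) ?_).congr ?_
    · exact WithTop.coe_le_coe.2 (le_top : ((2 + 1 : ℕ∞)) ≤ ⊤)
    · intro r hr
      apply derivWithin_congr_set
      filter_upwards [Ioi_mem_nhds hr.1] with y hy
      apply propext
      exact ⟨fun h => ⟨hy, h.2⟩, fun h => ⟨le_of_lt h.1, h.2⟩⟩
  have hwc : ContinuousOn (slopeFn u r₀) (Set.Icc 0 r₀) :=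
    hu1.continuousOn_derivWithin (uniqueDiffOn_Icc hr₀) le_rfl
  obtain ⟨L, hL⟩ := sa_main r₀ a b lam hr₀ (slopeFn u r₀) hwc hws hu0 hode
  exact sa_final (slopeFn u r₀) r₀ lam L hr₀ hwc (hws.of_le (by norm_num)) hL

end
end

section
/- (Expansion of the mean curvature at the axis.) Let r₀ > 0, a, b, λ ∈ ℝ, and let u ∈ C¹([0,r₀]) ∩ C^∞((0,r₀]) satisfy u'(0) = 0 and the hypotheses: (i) with w := u' and v := √(1+w²), on (0,r₀) the ODE w''(r) + (w(r)/r)' − [ (5w(r)/(2(1+w(r)²)))·w'(r)² + (w(r)³/(2r²))·(3+w(r)²) ] = (1/2)·v(r)⁵·a·r + b·v(r)⁴·w(r) + (λ/r)·v(r)⁵ holds; (ii) with H(r) := −(1/r)·(d/dr)[ r·u'(r)/√(1+u'(r)²) ] and K(r) := u''(r)·u'(r)/(r·(1+u'(r)²)²), on (0,r₀) the equation (1/(r√(1+u'(r)²)))·(d/dr)[ (r/√(1+u'(r)²))·H'(r) ] + (1/2)·H(r)·(H(r)² − 4K(r)) = a − b·H(r) holds. Then there exists a function H₀ on [0,r₀]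 of class C^{1,α} for every α ∈ (0,1) such that H(r) = −λ·ln(r) + H₀(r) for all r ∈ (0,r₀]. -/
open Real MeasureTheory

noncomputable section

/-- Mean curvature of the surface obtained by rotating the graph of `u`:
`H(r) = −(1/r) (d/dr)[r u'/√(1+u'²)]`. -/
def graphMeanCurv (u : ℝ → ℝ) (r₀ : ℝ) (r : ℝ) : ℝ :=
  -(1/r) * derivWithin
      (fun s => s * slopeFn u r₀ s / Real.sqrt (1 + (slopeFn u r₀ s) ^ 2))
      (Set.Icc 0 r₀) r

/-- Gauß curvature of the rotated graph: `K(r) = u'' u' / (r (1+u'²)²)`. -/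
def graphGaussCurv (u : ℝ → ℝ) (r₀ : ℝ) (r : ℝ) : ℝ :=
  derivWithin (slopeFn u r₀) (Set.Icc 0 r₀) r * slopeFn u r₀ r
    / (r * (1 + (slopeFn u r₀ r) ^ 2) ^ 2)


structure Dat (r₀ a b lam : ℝ) (w w1 w2 : ℝ → ℝ) : Prop where
  pos : 0 < r₀
  cw : ContinuousOn w (Set.Icc 0 r₀)
  w0 : w 0 = 0
  cw1 : ContinuousOn w1 (Set.Ioc 0 r₀)
  d1 : ∀ r ∈ Set.Ioo 0 r₀, HasDerivAt w (w1 r) r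
  d2 : ∀ r ∈ Set.Ioo 0 r₀, HasDerivAt w1 (w2 r) r
  ode : ∀ r ∈ Set.Ioo 0 r₀, w2 r + (w1 r / r - w r / r ^ 2)
        - ((5 * w r / (2 * (1 + (w r) ^ 2))) * (w1 r) ^ 2
            + ((w r) ^ 3 / (2 * r ^ 2)) * (3 + (w r) ^ 2))
        = (1/2) * (√(1 + (w r) ^ 2)) ^ 5 * a * r
          + b * (√(1 + (w r) ^ 2)) ^ 4 * w r
          + (lam / r) * (√(1 + (w r) ^ 2)) ^ 5

def HH (w w1 : ℝ → ℝ) (r : ℝ) : ℝ :=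
  -(w1 r / (√(1 + (w r) ^ 2)) ^ 3 + w r / (r * √(1 + (w r) ^ 2)))

def GG (a b lam : ℝ) (w w1 : ℝ → ℝ) (r : ℝ) : ℝ :=
  1 / 2 * w r * √(1 + (w r) ^ 2) * (HH w w1 r) ^ 2 + (w r) ^ 2 * HH w w1 r / r
    - lam * (w r) ^ 2 / r - 1 / 2 * (√(1 + (w r) ^ 2)) ^ 2 * a * r - b * √(1 + (w r) ^ 2) * w r

namespace Dat
variable {r₀ a b lam : ℝ} {w w1 w2 : ℝ → ℝ}

theorem vpos (x : ℝ) : 0 < √(1 + x ^ 2) := Real.sqrt_pos.2 (by positivity)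
theorem vsq (x : ℝ) : √(1 + x ^ 2) ^ 2 = 1 + x ^ 2 := Real.sq_sqrt (by positivity)
theorem vone (x : ℝ) : 1 ≤ √(1 + x ^ 2) := Real.one_le_sqrt.2 (by nlinarith [sq_nonneg x])

theorem cbound {f : ℝ → ℝ} (hf : ContinuousOn f (Set.Icc 0 r₀)) :
    ∃ C, 0 ≤ C ∧ ∀ r ∈ Set.Icc 0 r₀, |f r| ≤ C := by
  obtain ⟨C, hC⟩ := isCompact_Icc.exists_bound_of_continuousOn hf
  exact ⟨max C 0, le_max_right _ _, fun r hr => (hC r hr).trans (le_max_left _ _)⟩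

theorem rw1_bound (D : Dat r₀ a b lam w w1 w2) :
    ∃ M, 0 ≤ M ∧ ∀ r ∈ Set.Ioc 0 r₀, |r * w1 r| ≤ M := by
  obtain ⟨W, hW0, hW⟩ := cbound D.cw
  have hne : ∀ x : ℝ, (1 + x ^ 2) ≠ 0 := fun x => by positivity
  have hcw := D.cw
  have cE : ContinuousOn (fun r => (1 + (w r) ^ 2) ^ (-(5/4) : ℝ)) (Set.Icc 0 r₀) := by
    apply ContinuousOn.rpow_const (by fun_prop)
    intro x _; exact Or.inl (hne _)
  have cE2 : ContinuousOn (fun r => (1 + (w r) ^ 2) ^ ((5/4) : ℝ)) (Set.Icc 0 r₀) := by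
    apply ContinuousOn.rpow_const (by fun_prop)
    intro x _; exact Or.inl (hne _)
  obtain ⟨B, hB0, hB⟩ := cbound cE2
  obtain ⟨B1, hB10, hB1⟩ := cbound cE
  set N : ℝ → ℝ := fun r => (1 + (w r) ^ 2) ^ (-(5/4) : ℝ) *
    (w r + (w r) ^ 3 * (3 + (w r) ^ 2) / 2 + (1/2) * (√(1 + (w r) ^ 2)) ^ 5 * a * r ^ 3
          + b * (√(1 + (w r) ^ 2)) ^ 4 * w r * r ^ 2
          + lam * r * (√(1 + (w r) ^ 2)) ^ 5) with hN
  have cN : ContinuousOn N (Set.Icc 0 r₀) := by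
    apply cE.mul; fun_prop
  obtain ⟨M, hM0, hM⟩ := cbound cN
  set q : ℝ → ℝ := fun r => r * w1 r * (1 + (w r) ^ 2) ^ (-(5/4) : ℝ) with hq
  have dq : ∀ r ∈ Set.Ioo 0 r₀, HasDerivAt q (N r / r) r := by
    intro r hr
    have hr0 : r ≠ 0 := hr.1.ne'
    have h1 : HasDerivAt (fun r => 1 + (w r) ^ 2) (2 * w r * w1 r) r :=
      (((D.d1 r hr).pow 2).const_add 1).congr_deriv (by norm_num)
    have h2 := h1.rpow_const (p := (-(5/4) : ℝ)) (Or.inl (hne _))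
    have h3 := ((hasDerivAt_id r).mul (D.d2 r hr)).mul h2
    refine h3.congr_deriv ?_
    rw [Real.rpow_sub_one (hne _)]
    simp only [hN, Pi.mul_apply, id]
    have ho := D.ode r hr
    have h6 : w2 r = - (w1 r / r - w r / r ^ 2)
        + ((5 * w r / (2 * (1 + (w r) ^ 2))) * (w1 r) ^ 2
            + ((w r) ^ 3 / (2 * r ^ 2)) * (3 + (w r) ^ 2))
        + ((1/2) * (√(1 + (w r) ^ 2)) ^ 5 * a * r
          + b * (√(1 + (w r) ^ 2)) ^ 4 * w r
          + (lam / r) * (√(1 + (w r) ^ 2)) ^ 5) := by linarith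
    rw [h6]
    have := hne (w r)
    generalize (1 + (w r) ^ 2) ^ (-(5/4) : ℝ) = E
    generalize √(1 + (w r) ^ 2) = v
    field_simp
    ring
  have cq : ContinuousOn q (Set.Ioc 0 r₀) :=
    (continuousOn_id.mul D.cw1).mul (cE.mono Set.Ioc_subset_Icc_self)
  refine ⟨(4 * W * B1 + M) * B, by positivity, fun r hr => ?_⟩
  have hr0 := hr.1
  have hsub : Set.Icc (r/2) r ⊆ Set.Ioc 0 r₀ := fun x hx => ⟨by linarith [hx.1], hx.2.trans hr.2⟩
  have hsub' : Set.Ioo (r/2) r ⊆ Set.Ioo 0 r₀ :=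
    fun x hx => ⟨by linarith [hx.1], hx.2.trans_le hr.2⟩
  obtain ⟨ξ, hξ, e1⟩ := exists_hasDerivAt_eq_slope w w1 (show r/2 < r by linarith)
    (D.cw.mono (hsub.trans Set.Ioc_subset_Icc_self)) (fun x hx => D.d1 x (hsub' hx))
  have hξ1 := hξ.1
  have hξ2 := hξ.2
  have hξ0 : 0 < ξ := by linarith
  obtain ⟨η, hη, e2⟩ := exists_hasDerivAt_eq_slope q (fun r => N r / r) hξ.2
    (cq.mono ((Set.Icc_subset_Icc_left hξ.1.le).trans hsub))
      (fun x hx => dq x (hsub' ⟨hξ.1.trans hx.1, hx.2⟩))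
  have hη1 := hη.1
  have hη2 := hη.2
  have hη0 : 0 < η := by linarith
  have k1 : |ξ * w1 ξ| ≤ 4 * W := by
    have : w1 ξ * (r / 2) = w r - w (r/2) := by rw [e1]; field_simp; ring
    have a1 := hW r (Set.Ioc_subset_Icc_self hr)
    have a2 := hW (r/2) ⟨by linarith, by linarith [hr.2]⟩
    have : |w1 ξ| * (r/2) ≤ 2 * W := by
      rw [← abs_of_pos (show 0 < r/2 by linarith), ← abs_mul, this]
      refine (abs_sub _ _).trans ?_
      linarith
    rw [abs_mul, abs_of_pos hξ0]
    nlinarith [abs_nonneg (w1 ξ)]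
  have k2 : |q ξ| ≤ 4 * W * B1 := by
    simp only [hq]; rw [abs_mul]
    exact mul_le_mul k1 (hB1 ξ ⟨hξ0.le, hξ2.le.trans hr.2⟩) (abs_nonneg _) (by positivity)
  have k3 : |q r - q ξ| ≤ M := by
    have : q r - q ξ = N η / η * (r - ξ) := by
      rw [e2]; have : r - ξ ≠ 0 := by linarith
      field_simp
    rw [this, abs_mul, abs_div, abs_of_pos hη0, abs_of_pos (show 0 < r - ξ by linarith)]
    have := hM η ⟨hη0.le, hη2.le.trans hr.2⟩
    rw [div_mul_eq_mul_div, div_le_iff₀ hη0]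
    exact mul_le_mul this (by linarith) (by linarith) hM0
  have k4 : |q r| ≤ 4 * W * B1 + M := by
    have := abs_add_le (q ξ) (q r - q ξ)
    rw [add_sub_cancel] at this; linarith
  have k5 : r * w1 r = q r * (1 + (w r) ^ 2) ^ ((5/4) : ℝ) := by
    simp only [hq]
    rw [mul_assoc, ← Real.rpow_add (by positivity)]; simp
  rw [k5, abs_mul]
  exact mul_le_mul k4 (hB r (Set.Ioc_subset_Icc_self hr)) (abs_nonneg _) (by positivity)

theorem dv (D : Dat r₀ a b lam w w1 w2) {r : ℝ} (hr : r ∈ Set.Ioo 0 r₀) :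
    HasDerivAt (fun r => √(1 + (w r) ^ 2)) (w r * w1 r / √(1 + (w r) ^ 2)) r := by
  have h1 : HasDerivAt (fun r => 1 + (w r) ^ 2) (2 * w r * w1 r) r :=
    (((D.d1 r hr).pow 2).const_add 1).congr_deriv (by norm_num)
  have := h1.sqrt (by positivity)
  convert this using 1
  have := vpos (w r)
  field_simp

theorem dH (D : Dat r₀ a b lam w w1 w2) {r : ℝ} (hr : r ∈ Set.Ioo 0 r₀) :
    HasDerivAt (HH w w1) (GG a b lam w w1 r - lam / r) r := by
  have hr0 : r ≠ 0 := hr.1.ne'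
  have hv := vpos (w r)
  have hv2 := vsq (w r)
  have h1 := D.dv hr
  have h2 := (((D.d2 r hr).div (h1.pow 3) (pow_pos hv 3).ne').add
    ((D.d1 r hr).div ((hasDerivAt_id r).mul h1) (by simpa using ⟨hr0, hv.ne'⟩))).neg
  refine h2.congr_deriv ?_
  have ho := D.ode r hr
  have h6 : w2 r = - (w1 r / r - w r / r ^ 2)
        + ((5 * w r / (2 * (1 + (w r) ^ 2))) * (w1 r) ^ 2
            + ((w r) ^ 3 / (2 * r ^ 2)) * (3 + (w r) ^ 2))
        + ((1/2) * (√(1 + (w r) ^ 2)) ^ 5 * a * r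
          + b * (√(1 + (w r) ^ 2)) ^ 4 * w r
          + (lam / r) * (√(1 + (w r) ^ 2)) ^ 5) := by linarith
  rw [h6]
  simp only [GG, HH, Pi.mul_apply, Pi.pow_apply, id]
  generalize √(1 + (w r) ^ 2) = v at *
  simp only [← hv2]
  generalize w1 r = y at *
  have hw : (w r)^2 = v^2 - 1 := by linarith
  generalize w r = x at *
  have e3 : x ^ 3 = x * (v^2-1) := by rw [← hw]; ring
  have e5 : x ^ 5 = x * (v^2-1)^2 := by rw [← hw]; ring
  field_simp
  ring_nf
  simp only [hw, e3, e5]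
  ring_nf

theorem cH (D : Dat r₀ a b lam w w1 w2) : ContinuousOn (HH w w1) (Set.Ioc 0 r₀) := by
  have h1 := D.cw1
  have h2 := D.cw.mono Set.Ioc_subset_Icc_self
  unfold HH
  refine ((h1.div (by fun_prop) ?_).add (h2.div (by fun_prop) ?_)).neg
  · intro x _; have := vpos (w x); positivity
  · intro x hx; have := vpos (w x); have := hx.1; positivity

theorem rH_bound (D : Dat r₀ a b lam w w1 w2) :
    ∃ M, 0 ≤ M ∧ ∀ r ∈ Set.Ioc 0 r₀, |r * HH w w1 r| ≤ M := by
  obtain ⟨M, hM0, hM⟩ := D.rw1_bound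
  obtain ⟨W, hW0, hW⟩ := cbound D.cw
  refine ⟨M + W, by positivity, fun r hr => ?_⟩
  have hv := vone (w r)
  have hv3 : 1 ≤ √(1 + (w r) ^ 2) ^ 3 := one_le_pow₀ hv
  have h := hr.1
  have : r * HH w w1 r = -(r * w1 r / (√(1 + (w r) ^ 2)) ^ 3 + w r / √(1 + (w r) ^ 2)) := by
    unfold HH; field_simp
  rw [this, abs_neg]
  refine (abs_add_le _ _).trans (add_le_add ?_ ?_)
  · rw [abs_div, abs_of_pos (show 0 < √(1 + (w r) ^ 2) ^ 3 by linarith)]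
    exact (div_le_self (abs_nonneg _) hv3).trans (hM r hr)
  · rw [abs_div, abs_of_pos (show 0 < √(1 + (w r) ^ 2) by linarith)]
    exact (div_le_self (abs_nonneg _) hv).trans (hW r (Set.Ioc_subset_Icc_self hr))

theorem rH1_bound (D : Dat r₀ a b lam w w1 w2) {ε : ℝ} (hε : 0 < ε) :
    ∃ C, 0 ≤ C ∧ ∀ r ∈ Set.Ioc 0 r₀,
      |r * (GG a b lam w w1 r - lam / r)| ≤ ε / 2 * |HH w w1 r| + C := by
  obtain ⟨M, hM0, hM⟩ := D.rH_bound
  have hcw := D.cw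
  have c1 : ContinuousOn (fun r => - lam * (w r)^2 - 1 / 2 * (√(1 + (w r) ^ 2)) ^ 2 * a * r ^ 2
      - b * √(1 + (w r) ^ 2) * w r * r - lam) (Set.Icc 0 r₀) := by fun_prop
  obtain ⟨C, hC0, hC⟩ := cbound c1
  have c2 : ContinuousOn (fun r => 1 / 2 * |w r| * √(1 + (w r) ^ 2) * M + (w r)^2)
    (Set.Icc 0 r₀) := by fun_prop
  obtain ⟨K, hK0, hK⟩ := cbound c2
  have hev := (c2 0 ⟨le_rfl, D.pos.le⟩).eventually
    (gt_mem_nhds (show (1 / 2 * |w 0| * √(1 + (w 0) ^ 2) * M + (w 0)^2) < ε/2 by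
      simp [D.w0, hε]))
  rw [eventually_nhdsWithin_iff, Metric.eventually_nhds_iff] at hev
  obtain ⟨ρ, hρ, hs⟩ := hev
  refine ⟨K * (M / ρ) + C, by positivity, fun r hr => ?_⟩
  have hr0 := hr.1
  have hrI := Set.Ioc_subset_Icc_self hr
  have e : r * (GG a b lam w w1 r - lam / r) =
    (1 / 2 * w r * √(1 + (w r) ^ 2) * (r * HH w w1 r) + (w r)^2) * HH w w1 r
     + (- lam * (w r)^2 - 1 / 2 * (√(1 + (w r) ^ 2)) ^ 2 * a * r ^ 2
      - b * √(1 + (w r) ^ 2) * w r * r - lam) := by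
    unfold GG; field_simp; ring
  rw [e]
  refine (abs_add_le _ _).trans ?_
  have g1 := hC r hrI
  have g2 : |1 / 2 * w r * √(1 + (w r) ^ 2) * (r * HH w w1 r) + (w r)^2|
      ≤ 1 / 2 * |w r| * √(1 + (w r) ^ 2) * M + (w r)^2 := by
    refine (abs_add_le _ _).trans ?_
    rw [abs_of_nonneg (sq_nonneg (w r)), abs_mul, abs_mul, abs_mul, abs_of_pos (vpos (w r)),
      abs_of_pos (show (0:ℝ) < 1/2 by norm_num)]
    have := hM r hr
    gcongr
  rw [abs_mul]
  have hH0 := abs_nonneg (HH w w1 r)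
  by_cases h : r < ρ
  · have := hs (y := r) (by simpa [abs_of_pos hr0] using h) hrI
    have : |1 / 2 * w r * √(1 + (w r) ^ 2) * (r * HH w w1 r) + (w r)^2| * |HH w w1 r|
      ≤ ε/2 * |HH w w1 r| := by gcongr; linarith
    have : 0 ≤ K * (M/ρ) := by positivity
    linarith
  · have h3 : |HH w w1 r| ≤ M / ρ := by
      rw [le_div_iff₀ hρ]
      have := hM r hr
      rw [abs_mul, abs_of_pos hr0] at this
      nlinarith
    have := (le_abs_self _).trans (hK r hrI)
    have : |1 / 2 * w r * √(1 + (w r) ^ 2) * (r * HH w w1 r) + (w r)^2| * |HH w w1 r|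
      ≤ K * (M/ρ) := by gcongr; linarith
    have : 0 ≤ ε/2 * |HH w w1 r| := by positivity
    linarith

theorem H_bound (D : Dat r₀ a b lam w w1 w2) {ε : ℝ} (hε : 0 < ε) :
    ∃ C, 0 ≤ C ∧ ∀ r ∈ Set.Ioc 0 r₀, |HH w w1 r| ≤ C * r ^ (-ε) := by
  obtain ⟨C, hC0, hC⟩ := D.rH1_bound hε
  set N := C^2/ε^2 with hN
  set Φ : ℝ → ℝ := fun r => r ^ (2*ε) * ((HH w w1 r)^2 + N) with hΦ
  have cΦ : ContinuousOn Φ (Set.Ioc 0 r₀) := by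
    have := D.cH
    refine ContinuousOn.mul (ContinuousOn.rpow_const continuousOn_id ?_) (by fun_prop)
    intro x hx; exact Or.inl hx.1.ne'
  have dΦ : ∀ r ∈ Set.Ioo 0 r₀, HasDerivAt Φ (2 * ε * r^(2*ε-1) * ((HH w w1 r)^2 + N)
      + r^(2*ε) * (2 * HH w w1 r * (GG a b lam w w1 r - lam / r))) r := by
    intro r hr
    have h1 := Real.hasDerivAt_rpow_const (x := r) (p := 2*ε) (Or.inl hr.1.ne')
    have h2 := ((D.dH hr).pow 2).add_const N
    refine (h1.mul h2).congr_deriv ?_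
    simp
  have mono : MonotoneOn Φ (Set.Ioc 0 r₀) := by
    apply monotoneOn_of_deriv_nonneg (convex_Ioc _ _) cΦ
    · rw [interior_Ioc]; exact fun r hr => (dΦ r hr).differentiableAt.differentiableWithinAt
    · rw [interior_Ioc]; intro r hr
      rw [(dΦ r hr).deriv]
      have e : r^(2*ε) = r^(2*ε-1) * r := by
        rw [Real.rpow_sub_one hr.1.ne']; have := hr.1.ne'; field_simp
      rw [e]
      have := hC r (Set.Ioo_subset_Ioc_self hr)
      have e2 : 2 * ε * r^(2*ε-1) * ((HH w w1 r)^2 + N)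
        + r^(2*ε-1) * r * (2 * HH w w1 r * (GG a b lam w w1 r - lam / r))
        = r^(2*ε-1) * (2 * (ε * ((HH w w1 r)^2 + N) + HH w w1 r * (r * (GG a b lam w w1 r - lam / r)))) := by ring
      rw [e2]
      refine mul_nonneg (Real.rpow_nonneg hr.1.le _) (mul_nonneg (by norm_num) ?_)
      generalize r * (GG a b lam w w1 r - lam / r) = z at *
      generalize HH w w1 r = h at *
      have h1 : -(|h| * |z|) ≤ h * z := by rw [← abs_mul]; exact neg_abs_le _
      have h2 : |h| * |z| ≤ |h| * (ε / 2 * |h| + C) := by gcongr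
      have h3 : ε * N = C^2/ε := by rw [hN]; field_simp
      have h4 : |h|^2 = h^2 := sq_abs h
      have h5 : 0 ≤ ε/2 * |h|^2 - C * |h| + C^2/ε := by
        have : ε/2 * |h|^2 - C * |h| + C^2/ε = ε/2 * (|h| - C/ε)^2 + C^2/(2*ε) := by
          field_simp; ring
        rw [this]; positivity
      nlinarith
  refine ⟨√(Φ r₀), Real.sqrt_nonneg _, fun r hr => ?_⟩
  have h1 := mono hr ⟨D.pos, le_rfl⟩ hr.2
  have hN0 : 0 ≤ N := by positivity
  have hp := Real.rpow_pos_of_pos hr.1 ε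
  have h2 : (|HH w w1 r| * r^ε)^2 ≤ Φ r₀ := by
    refine le_trans ?_ h1
    simp only [hΦ]
    rw [mul_pow, sq_abs, two_mul, Real.rpow_add hr.1]
    nlinarith
  rw [Real.rpow_neg hr.1.le, ← div_eq_mul_inv, le_div_iff₀ hp]
  exact Real.le_sqrt_of_sq_le h2

theorem w_bound (D : Dat r₀ a b lam w w1 w2) {ε : ℝ} (hε : 0 < ε) (hε1 : ε < 1) :
    ∃ C, 0 ≤ C ∧ ∀ r ∈ Set.Ioc 0 r₀, |w r| ≤ C * r ^ (-ε) * r := by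
  obtain ⟨C, hC0, hC⟩ := D.H_bound hε
  have hcw := D.cw
  have c1 : ContinuousOn (fun r => √(1 + (w r) ^ 2)) (Set.Icc 0 r₀) := by fun_prop
  obtain ⟨V, hV0, hV⟩ := cbound c1
  set S : ℝ → ℝ := fun r => r * w r / √(1 + (w r) ^ 2) with hS
  have cS : ContinuousOn S (Set.Icc 0 r₀) := by
    refine ContinuousOn.div (by fun_prop) c1 (fun x _ => (vpos _).ne')
  have dS : ∀ r ∈ Set.Ioo 0 r₀, HasDerivAt S (-(r * HH w w1 r)) r := by
    intro r hr
    have hr0 : r ≠ 0 := hr.1.ne'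
    have hv := vpos (w r)
    have hv2 := vsq (w r)
    have h2 := ((hasDerivAt_id r).mul (D.d1 r hr)).div (D.dv hr) hv.ne'
    refine h2.congr_deriv ?_
    simp only [HH, Pi.mul_apply, id]
    generalize √(1 + (w r) ^ 2) = v at *
    have hw : (w r)^2 = v^2 - 1 := by linarith
    field_simp
    simp only [hw]
    ring
  refine ⟨C * V, by positivity, fun r hr => ?_⟩
  have hr0 := hr.1
  obtain ⟨ξ, hξ, e⟩ := exists_hasDerivAt_eq_slope S _ hr.1 (cS.mono (Set.Icc_subset_Icc_right hr.2))
    (fun x hx => dS x ⟨hx.1, hx.2.trans_le hr.2⟩)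
  have e1 : w r = -(ξ * HH w w1 ξ) * √(1 + (w r) ^ 2) := by
    rw [e]; simp only [hS]; have := vpos (w r); field_simp; simp; ring
  have h1 : |ξ * HH w w1 ξ| ≤ C * (r^(-ε) * r) := by
    rw [abs_mul, abs_of_pos hξ.1]
    have h2 := hC ξ ⟨hξ.1, hξ.2.le.trans hr.2⟩
    have h3 : ξ ^ (1-ε) ≤ r ^ (1-ε) := Real.rpow_le_rpow hξ.1.le hξ.2.le (by linarith)
    have e3 : ∀ x : ℝ, 0 < x → x^(1-ε) = x^(-ε) * x := by
      intro x hx; rw [sub_eq_neg_add, Real.rpow_add hx, Real.rpow_one]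
    rw [e3 _ hξ.1, e3 _ hr.1] at h3
    have h4 := mul_le_mul_of_nonneg_left h2 hξ.1.le
    have h5 := mul_le_mul_of_nonneg_left h3 hC0
    linarith
  rw [e1, abs_mul, abs_neg]
  have h2 := hV r (Set.Ioc_subset_Icc_self hr)
  calc _ ≤ C * (r^(-ε) * r) * V := mul_le_mul h1 h2 (abs_nonneg _) (by positivity)
    _ = _ := by ring

/-- explicit derivative of `GG`. -/
theorem dG (D : Dat r₀ a b lam w w1 w2) {r : ℝ} (hr : r ∈ Set.Ioo 0 r₀) :
    HasDerivAt (GG a b lam w w1)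
      (1/2 * (w1 r * √(1 + (w r) ^ 2) + w r ^ 2 * w1 r / √(1 + (w r) ^ 2)) * (HH w w1 r)^2
       + (w r / r) * √(1 + (w r) ^ 2) * HH w w1 r * (r * (GG a b lam w w1 r - lam / r))
       + 2 * (w r / r) * w1 r * HH w w1 r + (w r / r)^2 * (r * (GG a b lam w w1 r - lam / r))
       - (w r / r)^2 * HH w w1 r - lam * (2 * (w r / r) * w1 r - (w r / r)^2)
       - a * r ^ 2 * (w r / r) * w1 r - 1/2 * √(1 + (w r) ^ 2)^2 * a
       - b * (w r ^2 * w1 r / √(1 + (w r) ^ 2) + √(1 + (w r) ^ 2) * w1 r)) r := by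
  have hr0 : r ≠ 0 := hr.1.ne'
  have hv := vpos (w r)
  have hw := D.d1 r hr
  have hV := D.dv hr
  have hH := D.dH hr
  have hi := hasDerivAt_id r
  have h1 := ((hw.const_mul (1/2)).mul hV).mul (hH.pow 2)
  have h2 := ((hw.pow 2).mul hH).div hi hr0
  have h3 := ((hw.pow 2).const_mul lam).div hi hr0
  have h4 := (((hV.pow 2).const_mul (1/2)).mul_const a).mul hi
  have h5 := (hV.const_mul b).mul hw
  refine ((((h1.add h2).sub h3).sub h4).sub h5).congr_deriv ?_
  simp only [Pi.mul_apply, Pi.pow_apply, id]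
  generalize GG a b lam w w1 r - lam / r = z
  generalize HH w w1 r = h
  generalize √(1 + (w r) ^ 2) = v at *
  push_cast
  field_simp
  ring


theorem tri {c x y z K P : ℝ} (hc : |c| ≤ K) (hx : |x| ≤ P) (hy : |y| ≤ P) (hz : |z| ≤ P) :
    |c * (x * y * z)| ≤ K * P ^ 3 := by
  have hK := (abs_nonneg c).trans hc
  have hP := (abs_nonneg x).trans hx
  rw [abs_mul, abs_mul, abs_mul]
  calc |c| * (|x| * |y| * |z|) ≤ K * (P * P * P) := by gcongr
    _ = K * P ^ 3 := by ring

theorem alg1 {W V R P w v r y h z x : ℝ} (a b lam : ℝ) (hP : 1 ≤ P) (hw : |w| ≤ W) (hv1 : 1 ≤ v)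
    (hv : v ≤ V) (hr : 0 < r) (hrR : r ≤ R)
    (hy : |y| ≤ P) (hh : |h| ≤ P) (hz : |z| ≤ P) (hx : |x| ≤ P) :
    |1/2 * (x * v + w ^ 2 * x / v) * h^2 + y * v * h * z
       + 2 * y * x * h + y^2 * z - y^2 * h - lam * (2 * y * x - y^2)
       - a * r ^ 2 * y * x - 1/2 * v^2 * a - b * (w ^2 * x / v + v * x)|
     ≤ ((V + W^2) + V + 2 + 1 + 1 + |2 * lam| + |lam| + |a| * R^2 + |a| * V^2 + |b| * (V + W^2))
        * P^3 := by
  have h1 : |(1:ℝ)| ≤ P := by simpa using hP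
  have hv0 : 0 < v := by linarith
  have hw2 : w^2 ≤ W^2 := by rw [← sq_abs w]; gcongr
  have q : v + w^2/v ≤ V + W^2 := by
    have : w^2/v ≤ w^2 := div_le_self (sq_nonneg _) hv1
    linarith
  have q0 : 0 < v + w^2/v := by positivity
  have t1 := tri (c := 1/2 * (v + w^2/v)) (K := V + W^2) (by
    rw [abs_of_pos (by positivity)]; linarith) hx hh hh
  have t2 := tri (c := v) (K := V) (by rwa [abs_of_pos hv0]) hy hh hz
  have t3 := tri (c := 2) (K := 2) (by norm_num) hy hx hh
  have t4 := tri (c := 1) (K := 1) (by norm_num) hy hy hz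
  have t5 := tri (c := 1) (K := 1) (by norm_num) hy hy hh
  have t6 := tri (c := 2 * lam) le_rfl hy hx h1
  have t7 := tri (c := lam) le_rfl hy hy h1
  have t8 := tri (c := a * r^2) (K := |a| * R^2) (by
    rw [abs_mul, abs_of_pos (show 0 < r^2 by positivity)]; gcongr) hy hx h1
  have t9 := tri (c := 1/2 * (a * v^2)) (K := |a| * V^2) (by
    rw [abs_mul, abs_mul, abs_of_pos (show 0 < v^2 by positivity)]
    have : |a| * v^2 ≤ |a| * V^2 := by gcongr
    rw [abs_of_pos (by norm_num)]
    nlinarith [abs_nonneg a, sq_nonneg v, mul_nonneg (abs_nonneg a) (sq_nonneg v)]) h1 h1 h1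
  have t10 := tri (c := b * (v + w^2/v)) (K := |b| * (V + W^2)) (by
    rw [abs_mul, abs_of_pos q0]; gcongr) hx h1 h1
  rw [abs_le] at *
  constructor <;> ring_nf at * <;> linarith

theorem alg2 {V P v y h : ℝ} (a b lam : ℝ) (hP : 1 ≤ P) (hv1 : 1 ≤ v)
    (hv : v ≤ V) (hy : |y| ≤ P) (hh : |h| ≤ P) :
    |1/2 * y * v * h^2 + y^2 * h - lam * y^2 - 1/2 * v^2 * a - b * v * y|
     ≤ (V + 1 + |lam| + |a| * V^2 + |b| * V) * P^3 := by
  have h1 : |(1:ℝ)| ≤ P := by simpa using hP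
  have hv0 : 0 < v := by linarith
  have t2 := tri (c := 1/2*v) (K := V) (by rw [abs_of_pos (by positivity)]; linarith) hy hh hh
  have t5 := tri (c := 1) (K := 1) (by norm_num) hy hy hh
  have t7 := tri (c := lam) le_rfl hy hy h1
  have t9 := tri (c := 1/2 * (a * v^2)) (K := |a| * V^2) (by
    rw [abs_mul, abs_mul, abs_of_pos (show 0 < v^2 by positivity)]
    have : |a| * v^2 ≤ |a| * V^2 := by gcongr
    rw [abs_of_pos (by norm_num)]
    nlinarith [abs_nonneg a, sq_nonneg v, mul_nonneg (abs_nonneg a) (sq_nonneg v)]) h1 h1 h1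
  have t10 := tri (c := b * v) (K := |b| * V) (by
    rw [abs_mul, abs_of_pos hv0]; gcongr) hy h1 h1
  rw [abs_le] at *
  constructor <;> ring_nf at * <;> linarith

theorem G_bounds (D : Dat r₀ a b lam w w1 w2) {α : ℝ} (h0 : 0 < α) (h1 : α < 1) :
    ∃ C, 0 ≤ C ∧ (∀ r ∈ Set.Ioc 0 r₀, |GG a b lam w w1 r| ≤ C * r ^ α) ∧
      ∀ r ∈ Set.Ioo 0 r₀, ∃ g, HasDerivAt (GG a b lam w w1) g r ∧ |g| ≤ C * r ^ (α - 1) := by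
  set ε := (1 - α) / 3 with hεd
  have hε : 0 < ε := by rw [hεd]; linarith
  have hε1 : ε < 1 := by rw [hεd]; linarith
  obtain ⟨C1, hC10, hC1⟩ := D.H_bound hε
  obtain ⟨C2, hC20, hC2⟩ := D.w_bound hε hε1
  obtain ⟨C3, hC30, hC3⟩ := D.rH1_bound hε
  obtain ⟨W, hW0, hW⟩ := cbound D.cw
  have hcw := D.cw
  have c1 : ContinuousOn (fun r => √(1 + (w r) ^ 2)) (Set.Icc 0 r₀) := by fun_prop
  obtain ⟨V, hV0, hV⟩ := cbound c1
  have hp0 : 0 < r₀ ^ ε := Real.rpow_pos_of_pos D.pos _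
  set A := C1 + C2 + V^3 * (C1 + C2) + (ε/2 * C1 + C3 * r₀^ε) + r₀^ε with hA
  have hA0 : 0 ≤ A := by positivity
  have key : ∀ r ∈ Set.Ioc 0 r₀, 1 ≤ A * r^(-ε) ∧ |HH w w1 r| ≤ A * r^(-ε) ∧
      |w r / r| ≤ A * r^(-ε) ∧ |w1 r| ≤ A * r^(-ε) ∧
      |r * (GG a b lam w w1 r - lam / r)| ≤ A * r^(-ε) := by
    intro r hr
    have hr0 := hr.1
    have b1 := hC1 r hr
    have b2 := hC2 r hr
    have b3 := hC3 r hr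
    have hv := (le_abs_self _).trans (hV r (Set.Ioc_subset_Icc_self hr))
    have hv1 := vone (w r)
    have hp := Real.rpow_pos_of_pos hr.1 (-ε)
    have b0 : 1 ≤ r₀^ε * r^(-ε) := by
      rw [Real.rpow_neg hr.1.le, ← div_eq_mul_inv, le_div_iff₀ (Real.rpow_pos_of_pos hr.1 _), one_mul]
      exact Real.rpow_le_rpow hr.1.le hr.2 hε.le
    have b4 : |w r / r| ≤ C2 * r^(-ε) := by
      rw [abs_div, abs_of_pos hr.1, div_le_iff₀ hr.1]; exact b2
    have b5 : |w1 r| ≤ V^3 * (C1 + C2) * r^(-ε) := by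
      have e : w1 r = -(√(1 + (w r) ^ 2)^3 * HH w w1 r + √(1 + (w r) ^ 2)^2 * (w r / r)) := by
        unfold HH; have := vpos (w r); field_simp; ring
      rw [e, abs_neg]
      refine (abs_add_le _ _).trans ?_
      have hv0 := vpos (w r)
      rw [abs_mul, abs_mul, abs_of_pos (pow_pos hv0 3), abs_of_pos (pow_pos hv0 2)]
      have hvv : √(1 + (w r) ^ 2)^2 ≤ V^3 :=
        (pow_le_pow_right₀ hv1 (by norm_num : 2 ≤ 3)).trans (by gcongr)
      calc _ ≤ V^3 * (C1 * r^(-ε)) + V^3 * (C2 * r^(-ε)) := by gcongr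
        _ = _ := by ring
    have b6 : |r * (GG a b lam w w1 r - lam / r)| ≤ (ε/2 * C1 + C3 * r₀^ε) * r^(-ε) := by
      refine b3.trans ?_
      have := mul_le_mul_of_nonneg_left b1 (show 0 ≤ ε/2 by positivity)
      have := mul_le_mul_of_nonneg_left b0 hC30
      linarith
    have n1 : 0 ≤ C1 * r^(-ε) := by positivity
    have n2 : 0 ≤ C2 * r^(-ε) := by positivity
    have n3 : 0 ≤ V^3 * (C1 + C2) * r^(-ε) := by positivity
    have n4 : 0 ≤ (ε/2 * C1 + C3 * r₀^ε) * r^(-ε) := by positivity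
    have n5 : 0 ≤ r₀^ε * r^(-ε) := by positivity
    have eA : A * r^(-ε) = C1 * r^(-ε) + C2 * r^(-ε) + V^3 * (C1 + C2) * r^(-ε) +
      (ε/2 * C1 + C3 * r₀^ε) * r^(-ε) + r₀^ε * r^(-ε) := by rw [hA]; ring
    rw [eA]
    refine ⟨?_, ?_, ?_, ?_, ?_⟩ <;> linarith
  have eP : ∀ r : ℝ, 0 < r → (A * r^(-ε))^3 = A^3 * r^(α-1) := by
    intro r hr
    rw [mul_pow, ← Real.rpow_natCast (r^(-ε)), ← Real.rpow_mul hr.le]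
    congr 2
    rw [hεd]; push_cast; ring
  set K1 := ((V + W^2) + V + 2 + 1 + 1 + |2 * lam| + |lam| + |a| * r₀^2 + |a| * V^2 + |b| * (V + W^2))
  set K2 := (V + 1 + |lam| + |a| * V^2 + |b| * V)
  have hK1 : 0 ≤ K1 := by positivity
  have hK2 : 0 ≤ K2 := by positivity
  refine ⟨(K1 + K2) * A^3, by positivity, fun r hr => ?_, fun r hr => ⟨_, D.dG hr, ?_⟩⟩
  · obtain ⟨p1, p2, p3, p4, p5⟩ := key r hr
    have hr0 := hr.1
    have := alg2 a b lam p1 (vone (w r)) ((le_abs_self _).trans (hV r (Set.Ioc_subset_Icc_self hr))) p3 p2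
    rw [eP r hr.1] at this
    have e : GG a b lam w w1 r = r * (1/2 * (w r / r) * √(1 + (w r) ^ 2) * (HH w w1 r)^2
      + (w r / r)^2 * HH w w1 r - lam * (w r / r)^2 - 1/2 * √(1 + (w r) ^ 2)^2 * a
      - b * √(1 + (w r) ^ 2) * (w r / r)) := by
      unfold GG
      generalize HH w w1 r = h
      generalize √(1 + (w r) ^ 2) = v
      field_simp
    rw [e, abs_mul, abs_of_pos hr.1]
    have e2 : r^α = r * r^(α-1) := by
      rw [Real.rpow_sub_one hr.1.ne']; field_simp
    rw [e2]
    have hp := Real.rpow_pos_of_pos hr.1 (α-1)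
    calc _ ≤ r * (K2 * (A^3 * r^(α-1))) := by gcongr
      _ ≤ r * ((K1 + K2) * (A^3 * r^(α-1))) := by gcongr; linarith
      _ = _ := by ring
  · have hr' := Set.Ioo_subset_Ioc_self hr
    obtain ⟨p1, p2, p3, p4, p5⟩ := key r hr'
    have := alg1 a b lam p1 (hW r (Set.Ioc_subset_Icc_self hr')) (vone (w r))
      ((le_abs_self _).trans (hV r (Set.Ioc_subset_Icc_self hr'))) hr.1 hr.2.le p3 p2 p5 p4
    refine this.trans ?_
    rw [eP r hr.1]
    have hp := Real.rpow_pos_of_pos hr.1 (α-1)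
    calc _ ≤ (K1 + K2) * (A^3 * r^(α-1)) :=
          mul_le_mul_of_nonneg_right (le_add_of_nonneg_right hK2) (by positivity)
      _ = _ := by ring

theorem G_zero (D : Dat r₀ a b lam w w1 w2) : GG a b lam w w1 0 = 0 := by simp [GG, D.w0]

theorem cG (D : Dat r₀ a b lam w w1 w2) : ContinuousOn (GG a b lam w w1) (Set.Icc 0 r₀) := by
  obtain ⟨C, hC0, hC, -⟩ := D.G_bounds (α := 1/2) (by norm_num) (by norm_num)
  have c : ContinuousOn (GG a b lam w w1) (Set.Ioc 0 r₀) := by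
    have h1 := D.cH
    have h2 := D.cw.mono Set.Ioc_subset_Icc_self
    have hne : ∀ x ∈ Set.Ioc 0 r₀, x ≠ 0 := fun x hx => hx.1.ne'
    unfold GG
    fun_prop (disch := assumption)
  intro x hx
  rcases hx.1.eq_or_lt with rfl | hx0
  · have hz := D.G_zero
    unfold ContinuousWithinAt
    rw [hz]
    apply squeeze_zero_norm' (a := fun r => C * r ^ (1/2 : ℝ))
    · filter_upwards [self_mem_nhdsWithin] with r hr
      rcases hr.1.eq_or_lt with rfl | h
      · rw [hz]; simp
      · exact hC r ⟨h, hr.2⟩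
    · have : Continuous (fun r : ℝ => C * r ^ (1/2 : ℝ)) :=
        continuous_const.mul (Real.continuous_rpow_const (by norm_num))
      have := this.tendsto 0
      simp only [ne_eq, one_div, inv_eq_zero, OfNat.ofNat_ne_zero, not_false_eq_true,
        Real.zero_rpow, mul_zero] at this
      simpa using this.mono_left nhdsWithin_le_nhds
  · have := c x ⟨hx0, hx.2⟩
    refine this.mono_of_mem_nhdsWithin ?_
    filter_upwards [self_mem_nhdsWithin, mem_nhdsWithin_of_mem_nhds (lt_mem_nhds hx0)] with y h1 h2
    exact ⟨h2, h1.2⟩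

theorem rpow_diff {α x y : ℝ} (h0 : 0 < α) (h1 : α < 1) (hx : 0 ≤ x) (hxy : x ≤ y) :
    y^α - x^α ≤ (y - x)^α := by
  have := Real.rpow_add_le_add_rpow hx (sub_nonneg.2 hxy) h0.le h1.le
  rw [add_sub_cancel] at this
  linarith

theorem G_holder (D : Dat r₀ a b lam w w1 w2) {α : ℝ} (h0 : 0 < α) (h1 : α < 1) :
    ∃ C, ∀ x ∈ Set.Icc 0 r₀, ∀ y ∈ Set.Icc 0 r₀,
      |GG a b lam w w1 x - GG a b lam w w1 y| ≤ C * |x - y| ^ α := by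
  obtain ⟨C, hC0, -, hC⟩ := D.G_bounds h0 h1
  choose! g hg hgb using hC
  have cp : ContinuousOn (fun r : ℝ => C / α * r ^ α) (Set.Icc 0 r₀) :=
    (continuous_const.mul (Real.continuous_rpow_const h0.le)).continuousOn
  have dp : ∀ r ∈ Set.Ioo 0 r₀, HasDerivAt (fun r : ℝ => C / α * r ^ α) (C * r^(α-1)) r := by
    intro r hr
    refine ((Real.hasDerivAt_rpow_const (p := α) (Or.inl hr.1.ne')).const_mul (C/α)).congr_deriv ?_
    field_simp
  have m1 : MonotoneOn ((fun r : ℝ => C / α * r ^ α) + GG a b lam w w1) (Set.Icc 0 r₀) := by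
    apply monotoneOn_of_deriv_nonneg (convex_Icc _ _) (cp.add D.cG)
    · rw [interior_Icc]
      exact fun r hr => ((dp r hr).add (hg r hr)).differentiableAt.differentiableWithinAt
    · rw [interior_Icc]; intro r hr
      rw [((dp r hr).add (hg r hr)).deriv]
      linarith [(abs_le.1 (hgb r hr)).1]
  have m2 : MonotoneOn ((fun r : ℝ => C / α * r ^ α) - GG a b lam w w1) (Set.Icc 0 r₀) := by
    apply monotoneOn_of_deriv_nonneg (convex_Icc _ _) (cp.sub D.cG)
    · rw [interior_Icc]
      exact fun r hr => ((dp r hr).sub (hg r hr)).differentiableAt.differentiableWithinAt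
    · rw [interior_Icc]; intro r hr
      rw [((dp r hr).sub (hg r hr)).deriv]
      linarith [(abs_le.1 (hgb r hr)).2]
  have main : ∀ x ∈ Set.Icc 0 r₀, ∀ y ∈ Set.Icc 0 r₀, x ≤ y →
      |GG a b lam w w1 x - GG a b lam w w1 y| ≤ C / α * |x - y| ^ α := by
    intro x hx y hy hxy
    have a1 := m1 hx hy hxy
    have a2 := m2 hx hy hxy
    simp only [Pi.add_apply, Pi.sub_apply] at a1 a2
    have a3 := mul_le_mul_of_nonneg_left (rpow_diff h0 h1 hx.1 hxy) (show 0 ≤ C/α by positivity)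
    rw [abs_sub_comm x y, abs_of_nonneg (sub_nonneg.2 hxy), abs_le]
    constructor <;> linarith
  refine ⟨C/α, fun x hx y hy => ?_⟩
  rcases le_total x y with h | h
  · exact main x hx y hy h
  · rw [abs_sub_comm, abs_sub_comm x y]; exact main y hy x hx h

theorem concl (D : Dat r₀ a b lam w w1 w2) :
    ∃ H₀ : ℝ → ℝ, ContDiffOn ℝ 1 H₀ (Set.Icc 0 r₀) ∧
      (∀ α ∈ Set.Ioo (0:ℝ) 1, ∃ C : ℝ, ∀ x ∈ Set.Icc (0:ℝ) r₀, ∀ y ∈ Set.Icc (0:ℝ) r₀,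
        |derivWithin H₀ (Set.Icc 0 r₀) x - derivWithin H₀ (Set.Icc 0 r₀) y|
          ≤ C * |x - y| ^ α) ∧
      ∀ r ∈ Set.Ioc (0:ℝ) r₀, HH w w1 r = -lam * Real.log r + H₀ r := by
  have hr₀ := D.pos
  set Gt : ℝ → ℝ := Set.IccExtend hr₀.le ((Set.Icc 0 r₀).domRestrict (GG a b lam w w1)) with hGt
  have cGt : Continuous Gt := (continuousOn_iff_continuous_domRestrict.1 D.cG).Icc_extend'
  have eGt : ∀ r ∈ Set.Icc 0 r₀, Gt r = GG a b lam w w1 r := fun r hr => by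
    rw [hGt, Set.IccExtend_of_mem _ _ hr]; rfl
  set H₀ : ℝ → ℝ := fun r => (HH w w1 r₀ + lam * Real.log r₀) + ∫ t in r₀..r, Gt t with hH
  have dH0 : ∀ r, HasDerivAt H₀ (Gt r) r := fun r =>
    (intervalIntegral.integral_hasDerivAt_right (cGt.intervalIntegrable _ _)
      (cGt.stronglyMeasurableAtFilter _ _) cGt.continuousAt).const_add _
  have dW : ∀ r ∈ Set.Icc 0 r₀, derivWithin H₀ (Set.Icc 0 r₀) r = GG a b lam w w1 r :=
    fun r hr => by
      rw [(dH0 r).hasDerivWithinAt.derivWithin (uniqueDiffOn_Icc hr₀ r hr), eGt r hr]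
  refine ⟨H₀, ?_, ?_, ?_⟩
  · apply ContDiff.contDiffOn
    rw [contDiff_one_iff_deriv]
    refine ⟨fun r => (dH0 r).differentiableAt, ?_⟩
    have : deriv H₀ = Gt := funext fun r => (dH0 r).deriv
    rwa [this]
  · intro α hα
    obtain ⟨C, hC⟩ := D.G_holder hα.1 hα.2
    refine ⟨C, fun x hx y hy => ?_⟩
    rw [dW x hx, dW y hy]; exact hC x hx y hy
  · intro r hr
    have hc : ContinuousOn (fun r => HH w w1 r + lam * Real.log r) (Set.Icc r r₀) := by
      refine (D.cH.mono fun x hx => ⟨hr.1.trans_le hx.1, hx.2⟩).add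
        (continuousOn_const.mul (Real.continuousOn_log.mono fun x hx => ?_))
      exact (hr.1.trans_le hx.1).ne'
    have := intervalIntegral.integral_eq_sub_of_hasDerivAt_of_le (f' := Gt) hr.2 hc
      (fun x hx => by
        have hx' : x ∈ Set.Ioo 0 r₀ := ⟨hr.1.trans hx.1, hx.2⟩
        refine ((D.dH hx').add ((Real.hasDerivAt_log hx'.1.ne').const_mul lam)).congr_deriv ?_
        rw [eGt x (Set.Ioo_subset_Icc_self hx')]; ring)
      (cGt.intervalIntegrable _ _)
    simp only [hH]
    rw [intervalIntegral.integral_symm, this]; ring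

end Dat

theorem derivWithin_Icc_Ioc (f : ℝ → ℝ) {r₀ r : ℝ} (hr : r ∈ Set.Ioc 0 r₀) :
    derivWithin f (Set.Icc 0 r₀) r = derivWithin f (Set.Ioc 0 r₀) r := by
  apply derivWithin_congr_set
  filter_upwards [lt_mem_nhds hr.1] with y hy
  exact propext ⟨fun h => ⟨hy, h.2⟩, fun h => ⟨h.1.le, h.2⟩⟩

theorem smooth_step {f : ℝ → ℝ} {r₀ : ℝ} (hf : ContDiffOn ℝ (⊤ : ℕ∞) f (Set.Ioc 0 r₀)) :
    ContDiffOn ℝ (⊤ : ℕ∞) (derivWithin f (Set.Icc 0 r₀)) (Set.Ioc 0 r₀) :=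
  (hf.derivWithin (m := ((⊤ : ℕ∞) : WithTop ℕ∞)) (uniqueDiffOn_Ioc _ _) (by simp)).congr
    fun _ hx => derivWithin_Icc_Ioc f hx

theorem smooth_within {f : ℝ → ℝ} {r₀ r : ℝ} (hf : ContDiffOn ℝ (⊤ : ℕ∞) f (Set.Ioc 0 r₀))
    (hr : r ∈ Set.Ioc 0 r₀) :
    HasDerivWithinAt f (derivWithin f (Set.Icc 0 r₀) r) (Set.Icc 0 r₀) r := by
  have h := (hf.differentiableOn (by simp)) r hr
  refine (h.mono_of_mem_nhdsWithin ?_).hasDerivWithinAt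
  filter_upwards [self_mem_nhdsWithin, mem_nhdsWithin_of_mem_nhds (lt_mem_nhds hr.1)] with y h1 h2
  exact ⟨h2, h1.2⟩

theorem smooth_at {f : ℝ → ℝ} {r₀ r : ℝ} (hf : ContDiffOn ℝ (⊤ : ℕ∞) f (Set.Ioc 0 r₀))
    (hr : r ∈ Set.Ioo 0 r₀) :
    HasDerivAt f (derivWithin f (Set.Icc 0 r₀) r) r :=
  (smooth_within hf (Set.Ioo_subset_Ioc_self hr)).hasDerivAt (Icc_mem_nhds hr.1 hr.2)

/-- **Expansion of the mean curvature at the axis.** Under the once-integrated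
Euler–Lagrange ODE with residue `λ` and the constrained-Willmore equation in graph
coordinates, `H(r) = −λ ln r + H₀(r)` with `H₀ ∈ C^{1,α}([0,r₀])` for all `α ∈ (0,1)`. -/
theorem mean_curvature_expansion_at_axis (r₀ a b lam : ℝ) (hr₀ : 0 < r₀) (u : ℝ → ℝ)
    (hu1 : ContDiffOn ℝ 1 u (Set.Icc 0 r₀))
    (hus : ContDiffOn ℝ (⊤ : ℕ∞) u (Set.Ioc 0 r₀))
    (hu0 : slopeFn u r₀ 0 = 0)
    (hode : ∀ r ∈ Set.Ioo (0:ℝ) r₀,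
      deriv (deriv (slopeFn u r₀)) r + deriv (fun s => slopeFn u r₀ s / s) r
        - ((5 * slopeFn u r₀ r / (2 * (1 + (slopeFn u r₀ r) ^ 2)))
              * (deriv (slopeFn u r₀) r) ^ 2
            + ((slopeFn u r₀ r) ^ 3 / (2 * r ^ 2)) * (3 + (slopeFn u r₀ r) ^ 2))
        = (1/2) * (Real.sqrt (1 + (slopeFn u r₀ r) ^ 2)) ^ 5 * a * r
          + b * (Real.sqrt (1 + (slopeFn u r₀ r) ^ 2)) ^ 4 * slopeFn u r₀ r
          + (lam / r) * (Real.sqrt (1 + (slopeFn u r₀ r) ^ 2)) ^ 5)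
    (hweq : ∀ r ∈ Set.Ioo (0:ℝ) r₀,
      (1 / (r * Real.sqrt (1 + (slopeFn u r₀ r) ^ 2)))
          * derivWithin
              (fun s => (s / Real.sqrt (1 + (slopeFn u r₀ s) ^ 2))
                * derivWithin (graphMeanCurv u r₀) (Set.Icc 0 r₀) s)
              (Set.Icc 0 r₀) r
        + (1/2) * graphMeanCurv u r₀ r
            * ((graphMeanCurv u r₀ r) ^ 2 - 4 * graphGaussCurv u r₀ r)
        = a - b * graphMeanCurv u r₀ r) :
    ∃ H₀ : ℝ → ℝ, ContDiffOn ℝ 1 H₀ (Set.Icc 0 r₀) ∧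
      (∀ α ∈ Set.Ioo (0:ℝ) 1, ∃ C : ℝ, ∀ x ∈ Set.Icc (0:ℝ) r₀, ∀ y ∈ Set.Icc (0:ℝ) r₀,
        |derivWithin H₀ (Set.Icc 0 r₀) x - derivWithin H₀ (Set.Icc 0 r₀) y|
          ≤ C * |x - y| ^ α) ∧
      ∀ r ∈ Set.Ioc (0:ℝ) r₀, graphMeanCurv u r₀ r = -lam * Real.log r + H₀ r := by
  have sw : ContDiffOn ℝ (⊤ : ℕ∞) (slopeFn u r₀) (Set.Ioc 0 r₀) := smooth_step hus
  have sw1 := smooth_step sw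
  have D : Dat r₀ a b lam (slopeFn u r₀) (derivWithin (slopeFn u r₀) (Set.Icc 0 r₀))
      (derivWithin (derivWithin (slopeFn u r₀) (Set.Icc 0 r₀)) (Set.Icc 0 r₀)) := by
    refine ⟨hr₀, hu1.continuousOn_derivWithin (uniqueDiffOn_Icc hr₀) le_rfl, hu0,
      sw1.continuousOn, fun r hr => smooth_at sw hr, fun r hr => smooth_at sw1 hr, fun r hr => ?_⟩
    have h := hode r hr
    have e1 : deriv (slopeFn u r₀) r = derivWithin (slopeFn u r₀) (Set.Icc 0 r₀) r :=
      (smooth_at sw hr).deriv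
    have e2 : deriv (deriv (slopeFn u r₀)) r =
        derivWithin (derivWithin (slopeFn u r₀) (Set.Icc 0 r₀)) (Set.Icc 0 r₀) r := by
      rw [← (smooth_at sw1 hr).deriv]
      apply Filter.EventuallyEq.deriv_eq
      filter_upwards [Ioo_mem_nhds hr.1 hr.2] with x hx using (smooth_at sw hx).deriv
    have e3 : deriv (fun s => slopeFn u r₀ s / s) r =
        derivWithin (slopeFn u r₀) (Set.Icc 0 r₀) r / r - slopeFn u r₀ r / r ^ 2 := by
      have hr0 := hr.1.ne'
      refine (((smooth_at sw hr).div (hasDerivAt_id r) hr0).congr_deriv ?_).deriv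
      simp only [id]
      field_simp
    rw [e1, e2, e3] at h
    exact h
  obtain ⟨H₀, h1, h2, h3⟩ := D.concl
  refine ⟨H₀, h1, h2, fun r hr => ?_⟩
  rw [← h3 r hr]
  have hr0 := hr.1.ne'
  have hv := Dat.vpos (slopeFn u r₀ r)
  have hv2 := Dat.vsq (slopeFn u r₀ r)
  have d := smooth_within sw hr
  have dV := ((d.pow 2).const_add 1).sqrt (by simpa using (show (1 + slopeFn u r₀ r ^ 2) ≠ 0 by positivity))
  have dq := ((hasDerivWithinAt_id r (Set.Icc 0 r₀)).mul d).div dV hv.ne'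
  have e : derivWithin (fun s => s * slopeFn u r₀ s / √(1 + (slopeFn u r₀ s) ^ 2))
      (Set.Icc 0 r₀) r = _ := dq.derivWithin (uniqueDiffOn_Icc hr₀ r ⟨hr.1.le, hr.2⟩)
  unfold graphMeanCurv HH
  rw [e]
  simp only [Pi.mul_apply, Pi.pow_apply, id]
  generalize derivWithin (slopeFn u r₀) (Set.Icc 0 r₀) r = y
  generalize √(1 + (slopeFn u r₀ r) ^ 2) = v at *
  generalize slopeFn u r₀ r = x at *
  have hx : x ^ 2 = v ^ 2 - 1 := by linarith
  push_cast
  field_simp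
  simp only [hx]
  ring

end
end
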